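/- arXiv:1212.0157 — 3 statements merged into one kernel-verified Lean document; each statement's English description precedes it below -/
import Mathlib

section
/- For k ≥ 2, let A, B ⊆ ℕ and suppose g is a computable function such that for all (k−1)-element subsets x of ℕ, the B-c.e. set W^B_{g(x)} is a proper subset of {0,1,…,k−1} and contains |x ∩ A|. Then A is computable from B. (Kummer's cardinality theorem, as used in the paper.) -/
/-- A (total-style) Turing functional, given by a computable, monotone
approximation function mapping finite oracle prefixes to output values. -/
structure TuringFunctional where
  approx : List ℕ → ℕ → Option ℕ
  computable : Computable₂ approx
  mono : ∀ {l₁ l₂ : List ℕ} {n a : ℕ}, l₁ <+: l₂ → approx l₁ n = some a → approx l₂ n = some a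

/-- `Φ.evalsTo X Y` means the functional `Φ` with oracle `X` converges everywhere
and computes the total function `Y`. -/
def TuringFunctional.evalsTo (Φ : TuringFunctional) (X Y : ℕ → ℕ) : Prop :=
  ∀ n, ∃ m, Φ.approx ((List.range m).map X) n = some (Y n)

/-- Effective join of two oracles. -/
def join2 (X Y : ℕ → ℕ) : ℕ → ℕ := fun n => if n % 2 = 0 then X (n / 2) else Y (n / 2)

/-- Code a boolean-valued function (a set) as an oracle. -/
def bc (X : ℕ → Bool) : ℕ → ℕ := fun n => Bool.toNat (X n)

/-- Effective join of a countable sequence of sets into a single oracle. -/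
def seqJoin (A : ℕ → ℕ → Bool) : ℕ → ℕ := fun n => Bool.toNat (A n.unpair.1 n.unpair.2)

/-- The `B`-c.e. set uniformly enumerated (for parameter `e`) by the computable,
monotone enumeration operator `W`, with oracle `B`. -/
def WSet (W : List ℕ → ℕ → ℕ → Bool) (B : ℕ → Bool) (e : ℕ) : Set ℕ :=
  {c | ∃ m, W ((List.range m).map (bc B)) e c = true}


/-! ### Combinatorial part -/

/-- A full binary tree of depth `m` embeds above `σ`, with leaves in `T` and branching levels in `P`. -/
def KEmb (T : List Bool → Prop) : ℕ → (ℕ → Prop) → List Bool → Prop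
  | 0, _, σ => T σ
  | m + 1, P, σ => ∃ u, P (σ ++ u).length ∧ KEmb T m P (σ ++ u ++ [false]) ∧
      KEmb T m P (σ ++ u ++ [true])

theorem KEmb.mono {T : List Bool → Prop} {P Q : ℕ → Prop} (h : ∀ p, P p → Q p) :
    ∀ {m σ}, KEmb T m P σ → KEmb T m Q σ
  | 0, _, hh => hh
  | _ + 1, _, ⟨u, h1, h2, h3⟩ => ⟨u, h _ h1, h2.mono h, h3.mono h⟩

/-- Above a longer node (for positive depth, or when `T` is prefix closed) -/
theorem KEmb.up {T : List Bool → Prop} {P : ℕ → Prop}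
    (hT : ∀ σ u, T (σ ++ u) → T σ) {m σ u} (h : KEmb T m P (σ ++ u)) : KEmb T m P σ := by
  cases m with
  | zero => exact hT _ _ h
  | succ m =>
    obtain ⟨v, h1, h2, h3⟩ := h
    rw [List.append_assoc σ u v] at h1 h2 h3
    exact ⟨u ++ v, h1, h2, h3⟩

theorem KEmb.split {T : List Bool → Prop} (hT : ∀ σ u, T (σ ++ u) → T σ) {P : ℕ → Prop}
    (Q : ℕ → Prop) : ∀ (s a b : ℕ) (σ), a + b = s → KEmb T s P σ →
      KEmb T a (fun p => P p ∧ Q p) σ ∨ KEmb T b (fun p => P p ∧ ¬ Q p) σ := by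
  have base : ∀ s σ, KEmb T s P σ → T σ := by
    intro s
    induction s with
    | zero => intro σ h; exact h
    | succ s ih =>
      rintro σ ⟨u, _, h2, _⟩
      have := ih _ h2
      rw [List.append_assoc] at this
      exact hT _ _ this
  intro s
  induction s with
  | zero =>
    intro a b σ hab h
    have : a = 0 := by omega
    subst this
    exact Or.inl h
  | succ s ih =>
    intro a b σ hab h
    rcases a with _ | a
    · exact Or.inl (base _ _ h)
    rcases b with _ | b
    · exact Or.inr (base _ _ h)
    obtain ⟨u, h1, h2, h3⟩ := h
    by_cases hq : Q (σ ++ u).length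
    · rcases ih a (b+1) _ (by omega) h2 with e2 | e2
      · rcases ih a (b+1) _ (by omega) h3 with e3 | e3
        · exact Or.inl ⟨u, ⟨h1, hq⟩, e2, e3⟩
        · right; rw [List.append_assoc] at e3; exact e3.up hT
      · right; rw [List.append_assoc] at e2; exact e2.up hT
    · rcases ih (a+1) b _ (by omega) h2 with e2 | e2
      · left; rw [List.append_assoc] at e2; exact e2.up hT
      · rcases ih (a+1) b _ (by omega) h3 with e3 | e3
        · left; rw [List.append_assoc] at e3; exact e3.up hT
        · exact Or.inr ⟨u, ⟨h1, hq⟩, e2, e3⟩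

theorem KEmb.bound {T : List Bool → Prop} {P : ℕ → Prop} : ∀ (m : ℕ) (σ), KEmb T m P σ →
    ∃ ρ, T ρ ∧ σ <+: ρ ∧ KEmb T m (fun p => P p ∧ p < ρ.length) σ := by
  intro m
  induction m with
  | zero => intro σ h; exact ⟨σ, h, List.prefix_refl _, h⟩
  | succ m ih =>
    rintro σ ⟨u, h1, h2, h3⟩
    obtain ⟨ρ0, a0, b0, c0⟩ := ih _ h2
    obtain ⟨ρ1, a1, b1, c1⟩ := ih _ h3
    have l0 := b0.length_le
    have l1 := b1.length_le
    simp only [List.length_append, List.length_singleton] at l0 l1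
    rcases le_total ρ0.length ρ1.length with h | h
    · refine ⟨ρ1, a1, ⟨u ++ [true] ++ b1.choose, by simpa using b1.choose_spec⟩, u, ⟨h1, ?_⟩,
        c0.mono fun p hp => ⟨hp.1, by omega⟩, c1⟩
      simp only [List.length_append]; omega
    · refine ⟨ρ0, a0, ⟨u ++ [false] ++ b0.choose, by simpa using b0.choose_spec⟩, u, ⟨h1, ?_⟩,
        c0, c1.mono fun p hp => ⟨hp.1, by omega⟩⟩
      simp only [List.length_append]; omega

/-- The configuration: `a` positions, and rows realizing every count of bits equal to `c`. -/
def KS (T : List Bool → Prop) (P : ℕ → Prop) (σ : List Bool) (c : Bool) (a : ℕ) : Prop :=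
  ∃ x : Finset ℕ, x.card = a ∧ (∀ p ∈ x, P p ∧ σ.length ≤ p) ∧ ∀ i ≤ a, ∃ ρ, T ρ ∧ σ <+: ρ ∧
    (∀ p ∈ x, p < ρ.length) ∧ (x.filter fun p => ρ[p]? = some c).card = i

theorem KS.mono {T : List Bool → Prop} {P P' : ℕ → Prop} {σ σ' : List Bool} {c : Bool} {a : ℕ}
    (h : KS T P' σ' c a) (hP : ∀ p, P' p → P p) (hs : σ <+: σ') : KS T P σ c a := by
  obtain ⟨x, h1, h2, h3⟩ := h
  refine ⟨x, h1, fun p hp => ⟨hP _ (h2 p hp).1, hs.length_le.trans (h2 p hp).2⟩, fun i hi => ?_⟩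
  obtain ⟨ρ, r1, r2, r3⟩ := h3 i hi
  exact ⟨ρ, r1, hs.trans r2, r3⟩

theorem KS.step {T : List Bool → Prop} {P P' : ℕ → Prop} {σ τ ρ : List Bool} {c : Bool} {a : ℕ}
    (h : KS T P' (τ ++ [!c]) c a) (hP : ∀ p, P' p → P p) (hs : σ <+: τ)
    (hρ : T ρ) (hσρ : σ <+: ρ) (hb : ∀ p, P' p → ρ[p]? = some c) (hτ : P' τ.length) :
    KS T P σ c (a + 1) := by
  obtain ⟨x, h1, h2, h3⟩ := h
  have hn : τ.length ∉ x := fun hm => by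
    have := (h2 _ hm).2
    simp at this
  have hlt : ∀ p, P' p → p < ρ.length := fun p hp => (List.getElem?_eq_some_iff.1 (hb p hp)).1
  refine ⟨insert τ.length x, by rw [Finset.card_insert_of_notMem hn, h1], ?_, ?_⟩
  · intro p hp
    rcases Finset.mem_insert.1 hp with rfl | hp
    · exact ⟨hP _ hτ, hs.length_le⟩
    · refine ⟨hP _ (h2 p hp).1, ?_⟩
      have := (h2 p hp).2
      have := hs.length_le
      simp at *; omega
  · intro i hi
    rcases Nat.lt_or_ge a i with hlt' | hle
    · have : i = a + 1 := by omega
      subst this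
      refine ⟨ρ, hρ, hσρ, ?_, ?_⟩
      · intro p hp
        rcases Finset.mem_insert.1 hp with rfl | hp
        · exact hlt _ hτ
        · exact hlt _ (h2 p hp).1
      · rw [Finset.filter_true_of_mem, Finset.card_insert_of_notMem hn, h1]
        intro p hp
        rcases Finset.mem_insert.1 hp with rfl | hp
        · exact hb _ hτ
        · exact hb _ (h2 p hp).1
    · obtain ⟨r, r1, r2, r3, r4⟩ := h3 i hle
      obtain ⟨v, hv⟩ := r2
      refine ⟨r, r1, hs.trans ⟨[!c] ++ v, by rw [← hv, List.append_assoc]⟩, ?_, ?_⟩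
      · intro p hp
        rcases Finset.mem_insert.1 hp with rfl | hp
        · rw [← hv]; simp
        · exact r3 p hp
      · rw [Finset.filter_insert, if_neg, r4]
        rw [← hv]
        simp

theorem KEmb.config {T : List Bool → Prop} (hT : ∀ σ u, T (σ ++ u) → T σ) :
    ∀ s a b : ℕ, a + b = s → ∃ m, ∀ P σ, KEmb T m P σ → KS T P σ false a ∨ KS T P σ true b := by
  intro s
  have triv : ∀ P σ c, T σ → KS T P σ c 0 := fun P σ c h =>
    ⟨∅, by simp, by simp, fun i hi => ⟨σ, h, List.prefix_refl _, by simp, by simp; omega⟩⟩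
  induction s with
  | zero =>
    intro a b hab
    obtain ⟨rfl, rfl⟩ : a = 0 ∧ b = 0 := by omega
    exact ⟨0, fun P σ h => Or.inl (triv _ _ _ h)⟩
  | succ s ih =>
    intro a b hab
    rcases a with _ | a
    · exact ⟨0, fun P σ h => Or.inl (triv _ _ _ h)⟩
    rcases b with _ | b
    · exact ⟨0, fun P σ h => Or.inr (triv _ _ _ h)⟩
    obtain ⟨m0, h0⟩ := ih a (b+1) (by omega)
    obtain ⟨m1, h1⟩ := ih (a+1) b (by omega)
    refine ⟨((m0 + 1) + (m1 + 1)) + 1, fun P σ hσ => ?_⟩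
    -- the core step: a long side branch `ρ` and a main subtree
    have core : ∀ σ' ρ, σ <+: σ' → T ρ → σ <+: ρ →
        KEmb T ((m0 + 1) + (m1 + 1)) (fun p => P p ∧ p < ρ.length) σ' →
        KS T P σ false (a+1) ∨ KS T P σ true (b+1) := by
      intro σ' ρ hs hρ hσρ he
      rcases KEmb.split hT (fun p => ρ[p]? = some false) _ _ _ _ rfl he with e | e
      · obtain ⟨u, hu, -, e'⟩ := e
        have hpre : σ <+: σ' ++ u := hs.trans (List.prefix_append _ _)
        rcases h0 _ _ e' with k | k
        · exact Or.inl (KS.step k (fun p hp => hp.1.1) hpre hρ hσρ (fun p hp => hp.2) hu)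
        · exact Or.inr (k.mono (fun p hp => hp.1.1) (hpre.trans (List.prefix_append _ _)))
      · obtain ⟨u, hu, e', -⟩ := e
        have hpre : σ <+: σ' ++ u := hs.trans (List.prefix_append _ _)
        rcases h1 _ _ e' with k | k
        · exact Or.inl (k.mono (fun p hp => hp.1.1) (hpre.trans (List.prefix_append _ _)))
        · refine Or.inr (KS.step k (fun p hp => hp.1.1) hpre hρ hσρ (fun p hp => ?_) hu)
          have := hp.2
          rw [List.getElem?_eq_getElem hp.1.2] at this ⊢
          simpa using this
    obtain ⟨u, hu, e0, e1⟩ := hσ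
    obtain ⟨ρ0, a0, b0, c0⟩ := e0.bound
    obtain ⟨ρ1, a1, b1, c1⟩ := e1.bound
    have p0 : σ <+: σ ++ u ++ [false] := ⟨u ++ [false], by simp⟩
    have p1 : σ <+: σ ++ u ++ [true] := ⟨u ++ [true], by simp⟩
    rcases le_total ρ0.length ρ1.length with h | h
    · exact core _ ρ1 p0 a1 (p1.trans b1) (c0.mono fun p hp => ⟨hp.1, by omega⟩)
    · exact core _ ρ0 p1 a0 (p0.trans b0) (c1.mono fun p hp => ⟨hp.1, by omega⟩)

/-- `A` restricted to `l`. -/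
def kpre (A : ℕ → Bool) (l : ℕ) : List Bool := (List.range l).map A

theorem KEmb.unique {T : List Bool → Prop} (hT : ∀ σ u, T (σ ++ u) → T σ) (A : ℕ → Bool)
    (m l0 : ℕ) (h1 : ∀ l, KEmb T m (fun _ => True) (kpre A l))
    (h2 : ¬ KEmb T (m+1) (fun _ => True) (kpre A l0)) (u : List Bool)
    (hu : KEmb T m (fun _ => True) (kpre A l0 ++ u)) :
    ∀ j ≤ u.length, u.take j = (List.range j).map fun i => A (l0 + i) := by
  have hk : ∀ j, kpre A l0 ++ (List.range j).map (fun i => A (l0 + i)) = kpre A (l0 + j) := by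
    intro j; simp [kpre, List.range_add]
  intro j
  induction j with
  | zero => simp
  | succ j ih =>
    intro hj
    have ihj := ih (by omega)
    have hj' : j < u.length := by omega
    rw [List.take_succ_eq_append_getElem hj', ihj, List.range_succ, List.map_append]
    congr 1
    simp only [List.map_cons, List.map_nil, List.cons.injEq, and_true]
    by_contra hne
    apply h2
    have e1 : KEmb T m (fun _ => True) (kpre A l0 ++ u.take j ++ [u[j]]) := by
      have : kpre A l0 ++ u = (kpre A l0 ++ u.take j ++ [u[j]]) ++ u.drop (j+1) := by
        rw [List.append_assoc (kpre A l0), ← List.take_succ_eq_append_getElem hj',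
          List.append_assoc, List.take_append_drop]
      rw [this] at hu
      exact hu.up hT
    have e2 : KEmb T m (fun _ => True) (kpre A l0 ++ u.take j ++ [A (l0 + j)]) := by
      rw [ihj, hk]
      have := h1 (l0 + j + 1)
      simpa [kpre, List.range_succ] using this
    refine ⟨u.take j, trivial, ?_⟩
    cases hA : A (l0 + j) <;> cases hB : u[j] <;> simp_all


/-! ### Computability part -/

/-- Prefix of the oracle. -/
def kor (B : ℕ → Bool) (j : ℕ) : List ℕ := (List.range j).map (bc B)

theorem kor_prefix (B : ℕ → Bool) {i j : ℕ} (h : i ≤ j) : kor B i <+: kor B j := by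
  obtain ⟨d, rfl⟩ := Nat.exists_eq_add_of_le h
  exact ⟨_, by simp only [kor]; rw [List.range_add, List.map_append]⟩

/-- `B`-c.e. predicates. -/
def KCE (B : ℕ → Bool) {α : Type} [Primcodable α] (R : α → Prop) : Prop :=
  ∃ D : List ℕ → α → Bool, Computable₂ D ∧
    (∀ l l' a, l <+: l' → D l a = true → D l' a = true) ∧
    ∀ a, R a ↔ ∃ j, D (kor B j) a = true

section
variable {B : ℕ → Bool} {α β : Type} [Primcodable α] [Primcodable β]

theorem KCE.congr {R S : α → Prop} (h : KCE B R) (hS : ∀ a, S a ↔ R a) : KCE B S := by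
  obtain ⟨D, h1, h2, h3⟩ := h
  exact ⟨D, h1, h2, fun a => (hS a).trans (h3 a)⟩

theorem KCE.comp {R : β → Prop} (h : KCE B R) {f : α → β} (hf : Computable f) :
    KCE B fun a => R (f a) := by
  obtain ⟨D, h1, h2, h3⟩ := h
  exact ⟨fun l a => D l (f a), h1.comp Computable.fst (hf.comp Computable.snd),
    fun l l' a => h2 l l' (f a), fun a => h3 (f a)⟩

theorem KCE.dec {f : α → Bool} (hf : Computable f) : KCE B fun a => f a = true :=
  ⟨fun _ a => f a, (hf.comp Computable.snd), fun _ _ _ _ h => h, fun a => by simp⟩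

theorem KCE.and {R S : α → Prop} (hR : KCE B R) (hS : KCE B S) : KCE B fun a => R a ∧ S a := by
  obtain ⟨D, h1, h2, h3⟩ := hR
  obtain ⟨E, g1, g2, g3⟩ := hS
  refine ⟨fun l a => D l a && E l a, (Primrec.and.to_comp.comp h1 g1), ?_, ?_⟩
  · intro l l' a hl
    simp only [Bool.and_eq_true]
    exact fun h => ⟨h2 _ _ _ hl h.1, g2 _ _ _ hl h.2⟩
  · intro a
    simp only [h3, g3, Bool.and_eq_true]
    constructor
    · rintro ⟨⟨i, hi⟩, ⟨j, hj⟩⟩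
      exact ⟨max i j, h2 _ _ _ (kor_prefix B (le_max_left _ _)) hi,
        g2 _ _ _ (kor_prefix B (le_max_right _ _)) hj⟩
    · rintro ⟨j, h, h'⟩
      exact ⟨⟨j, h⟩, ⟨j, h'⟩⟩

theorem KCE.ball {R : α × ℕ → Prop} (hR : KCE B R) {N : α → ℕ} (hN : Computable N) :
    KCE B fun a => ∀ i < N a, R (a, i) := by
  obtain ⟨D, h1, h2, h3⟩ := hR
  have spec : ∀ l a n, (Nat.rec true (fun i IH => IH && D l (a, i)) n : Bool) = true ↔
      ∀ i < n, D l (a, i) = true := by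
    intro l a n
    induction n with
    | zero => simp
    | succ n ih =>
      simp only [Bool.and_eq_true, ih, Nat.forall_lt_succ_right]
  refine ⟨fun l a => Nat.rec true (fun i IH => IH && D l (a, i)) (N a), ?_, ?_, ?_⟩
  · refine Computable.nat_rec (α := List ℕ × α) (f := fun p => N p.2) (g := fun _ => true)
      (h := fun p q => q.2 && D p.1 (p.2, q.1)) (hN.comp Computable.snd) (Computable.const _) ?_
    refine Primrec.and.to_comp.comp (Computable.snd.comp Computable.snd) (h1.comp
      (Computable.fst.comp Computable.fst) (Computable.pair
      (Computable.snd.comp Computable.fst) (Computable.fst.comp Computable.snd)))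
  · intro l l' a hl
    rw [spec, spec]
    exact fun h i hi => h2 _ _ _ hl (h i hi)
  · intro a
    simp only [spec, h3]
    generalize N a = n
    constructor
    · intro h
      induction n with
      | zero => exact ⟨0, by simp⟩
      | succ n ih =>
        obtain ⟨j, hj⟩ := ih fun i hi => h i (by omega)
        obtain ⟨j', hj'⟩ := h n (by omega)
        refine ⟨max j j', fun i hi => ?_⟩
        rcases Nat.lt_succ_iff_lt_or_eq.1 hi with hi | rfl
        · exact h2 _ _ _ (kor_prefix B (le_max_left _ _)) (hj i hi)
        · exact h2 _ _ _ (kor_prefix B (le_max_right _ _)) hj'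
    · rintro ⟨j, hj⟩ i hi
      exact ⟨j, hj i hi⟩

theorem KCE.ex {R : α × β → Prop} (hR : KCE B R) : KCE B fun a => ∃ b, R (a, b) := by
  obtain ⟨D, h1, h2, h3⟩ := hR
  let E : List ℕ → α → ℕ → Bool := fun l a i =>
    Option.casesOn (motive := fun _ => Bool) (Encodable.decode (α := β) i) false fun b => D l (a, b)
  have hE : ∀ l a i, E l a i = true ↔ ∃ b, Encodable.decode (α := β) i = some b ∧
      D l (a, b) = true := by
    intro l a i
    simp only [E]
    cases Encodable.decode (α := β) i <;> simp
  have spec : ∀ l a n, (Nat.rec false (fun i IH => IH || E l a i) n : Bool) = true ↔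
      ∃ i < n, E l a i = true := by
    intro l a n
    induction n with
    | zero => simp
    | succ n ih =>
      simp only [Bool.or_eq_true, ih, Nat.exists_lt_succ_right]
  refine ⟨fun l a => Nat.rec false (fun i IH => IH || E l a i) l.length, ?_, ?_, ?_⟩
  · refine Computable.nat_rec (α := List ℕ × α) (f := fun p => p.1.length) (g := fun _ => false)
      (h := fun p q => q.2 || E p.1 p.2 q.1) (Computable.list_length.comp Computable.fst)
      (Computable.const _) ?_
    refine Primrec.or.to_comp.comp (Computable.snd.comp Computable.snd) ?_
    refine Computable.option_casesOn (α := (List ℕ × α) × ℕ × Bool)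
      (o := fun p => Encodable.decode (α := β) p.2.1) (f := fun _ => false)
      (g := fun p b => D p.1.1 (p.1.2, b))
      (Computable.decode.comp (Computable.fst.comp Computable.snd)) (Computable.const _) ?_
    refine h1.comp (Computable.fst.comp (Computable.fst.comp Computable.fst)) (Computable.pair
      (Computable.snd.comp (Computable.fst.comp Computable.fst)) Computable.snd)
  · intro l l' a hl
    simp only [spec, hE]
    rintro ⟨i, hi, b, hb, hd⟩
    exact ⟨i, hi.trans_le hl.length_le, b, hb, h2 _ _ _ hl hd⟩
  · intro a
    simp only [spec, hE, h3]
    constructor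
    · rintro ⟨b, j, hj⟩
      refine ⟨max j (Encodable.encode b + 1), Encodable.encode b, ?_, b, Encodable.encodek b,
        h2 _ _ _ (kor_prefix B (le_max_left _ _)) hj⟩
      simp [kor]
    · rintro ⟨j, i, -, b, -, hd⟩
      exact ⟨b, j, hd⟩

end

theorem KCE.turing {A B : ℕ → Bool} (h1 : KCE B fun n => A n = true)
    (h0 : KCE B fun n => A n = false) : ∃ Ξ : TuringFunctional, Ξ.evalsTo (bc B) (bc A) := by
  obtain ⟨D, d1, d2, d3⟩ := h1
  obtain ⟨E, e1, e2, e3⟩ := h0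
  let f : List ℕ → ℕ → Option ℕ := fun l n => bif D l n then some 1 else bif E l n then some 0 else none
  have hf : Computable₂ f :=
    Computable.cond d1 (Computable.const _) (Computable.cond e1 (Computable.const _) (Computable.const _))
  let F : List ℕ → ℕ → ℕ → Option ℕ := fun l n i =>
    Nat.rec none (fun i IH => Option.casesOn (motive := fun _ => Option ℕ) IH
      (f (l.take i) n) fun v => some v) i
  have F0 : ∀ l n, F l n 0 = none := fun _ _ => rfl
  have Fs : ∀ l n i, F l n (i+1) = Option.casesOn (motive := fun _ => Option ℕ) (F l n i)
      (f (l.take i) n) fun v => some v := fun _ _ _ => rfl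
  have Fmono : ∀ l n i j a, i ≤ j → F l n i = some a → F l n j = some a := by
    intro l n i j a hij h
    induction hij with
    | refl => exact h
    | step _ ih => rw [Fs, ih]
  have Fpre : ∀ l l' n i, l <+: l' → i ≤ l.length + 1 → F l n i = F l' n i := by
    rintro l _ n i ⟨t, rfl⟩ hi
    induction i with
    | zero => rfl
    | succ i ih =>
      rw [Fs, Fs, ih (by omega), List.take_append_of_le_length (by omega)]
  have hFc : Computable₂ fun l n => F l n (l.length + 1) := by
    refine Computable.nat_rec (α := List ℕ × ℕ) (σ := Option ℕ) (f := fun p => p.1.length + 1)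
      (g := fun _ => none)
      (h := fun p q => Option.casesOn (motive := fun _ => Option ℕ) q.2
      (f (p.1.take q.1) p.2) fun v => some v)
      (Computable.succ.comp (Computable.list_length.comp Computable.fst)) (Computable.const _) ?_
    refine Computable.option_casesOn (α := (List ℕ × ℕ) × ℕ × Option ℕ)
      (o := fun p => p.2.2) (f := fun p => f (p.1.1.take p.2.1) p.1.2)
      (g := fun _ v => some v) (Computable.snd.comp Computable.snd) ?_
      (Computable.option_some.comp Computable.snd)
    refine hf.comp (Primrec.list_take.to_comp.comp (Computable.fst.comp Computable.snd)
      (Computable.fst.comp Computable.fst)) (Computable.snd.comp Computable.fst)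
  refine ⟨⟨fun l n => F l n (l.length + 1), hFc, ?_⟩, ?_⟩
  · intro l l' n a hl h
    refine Fmono _ _ (l.length + 1) _ _ (Nat.succ_le_succ hl.length_le) ?_
    rw [← Fpre l l' n _ hl le_rfl]; exact h
  · intro n
    -- correctness of any value
    have good : ∀ j v, f (kor B j) n = some v → v = bc A n := by
      intro j v hv
      simp only [f] at hv
      cases hD : D (kor B j) n
      · cases hE : E (kor B j) n
        · simp [hD, hE] at hv
        · have := (e3 n).2 ⟨j, hE⟩
          simp [hD, hE] at hv
          simp [bc, this, hv]
      · have := (d3 n).2 ⟨j, hD⟩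
        simp [hD] at hv
        simp [bc, this, hv]
    have tk : ∀ j i, i ≤ j → (kor B j).take i = kor B i := by
      intro j i h
      obtain ⟨t, ht⟩ := kor_prefix B h
      rw [← ht, List.take_append_of_le_length (by simp [kor]), List.take_of_length_le (by simp [kor])]
    have goodF : ∀ j i v, i ≤ j + 1 → F (kor B j) n i = some v → v = bc A n := by
      intro j i
      induction i with
      | zero => intro v _ h; simp [F0] at h
      | succ i ih =>
        intro v hi h
        rw [Fs] at h
        cases hF : F (kor B j) n i with
        | none =>
          rw [hF, tk _ _ (by omega)] at h
          exact good _ _ h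
        | some w =>
          rw [hF] at h
          have : w = v := by simpa using h
          exact this ▸ ih w (by omega) hF
    have hex : ∃ j v, f (kor B j) n = some v := by
      cases hA : A n
      · obtain ⟨j, hj⟩ := (e3 n).1 hA
        refine ⟨j, ?_⟩
        simp only [f, hj]
        cases D (kor B j) n <;> simp
      · obtain ⟨j, hj⟩ := (d3 n).1 hA
        exact ⟨j, by simp [f, hj]⟩
    obtain ⟨j, v, hv⟩ := hex
    refine ⟨j, ?_⟩
    change F (kor B j) n ((kor B j).length + 1) = some (bc A n)
    have hl : (kor B j).length = j := by simp [kor]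
    rw [hl]
    have : ∃ w, F (kor B j) n (j+1) = some w := by
      rw [Fs]
      cases hF : F (kor B j) n j with
      | none => exact ⟨v, by rw [tk _ _ le_rfl]; exact hv⟩
      | some w => exact ⟨w, rfl⟩
    obtain ⟨w, hw⟩ := this
    rw [hw, goodF j (j+1) w le_rfl hw]

/-! ### The tree of consistent strings -/

/-- Consistency condition, by recursion on the number of positions left to choose. -/
def KQ (V : ℕ → ℕ → Prop) : ℕ → List Bool × ℕ × List ℕ × ℕ → Prop
  | 0, q => V (Encodable.encode q.2.2.1) q.2.2.2
  | n + 1, q => ∀ y < q.2.1, KQ V n (q.1, y, y :: q.2.2.1,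
      q.2.2.2 + (bif q.1[y]?.getD false then 1 else 0))

theorem KQ.ce {B : ℕ → Bool} {V : ℕ → ℕ → Prop} (hV : KCE B fun p : ℕ × ℕ => V p.1 p.2) (n : ℕ) :
    KCE B (KQ V n) := by
  induction n with
  | zero =>
    refine (hV.comp (f := fun q : List Bool × ℕ × List ℕ × ℕ =>
      (Encodable.encode q.2.2.1, q.2.2.2)) ?_).congr fun a => Iff.rfl
    exact Computable.pair (Computable.encode.comp (Computable.fst.comp (Computable.snd.comp
      Computable.snd))) (Computable.snd.comp (Computable.snd.comp Computable.snd))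
  | succ n ih =>
    have : Computable (fun p : (List Bool × ℕ × List ℕ × ℕ) × ℕ =>
        (p.1.1, p.2, p.2 :: p.1.2.2.1,
          p.1.2.2.2 + (bif p.1.1[p.2]?.getD false then 1 else 0))) := by
      have c1 : Computable (fun p : (List Bool × ℕ × List ℕ × ℕ) × ℕ => p.1.1) :=
        Computable.fst.comp Computable.fst
      have c2 : Computable (fun p : (List Bool × ℕ × List ℕ × ℕ) × ℕ => p.1.2.2.1) :=
        Computable.fst.comp (Computable.snd.comp (Computable.snd.comp Computable.fst))
      have c3 : Computable (fun p : (List Bool × ℕ × List ℕ × ℕ) × ℕ => p.1.2.2.2) :=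
        Computable.snd.comp (Computable.snd.comp (Computable.snd.comp Computable.fst))
      refine c1.pair (Computable.snd.pair ((Computable.list_cons.comp Computable.snd c2).pair ?_))
      refine Primrec.nat_add.to_comp.comp c3 (Computable.cond ?_ (Computable.const _)
        (Computable.const _))
      exact Computable.option_getD (Computable.list_getElem?.comp c1 Computable.snd)
        (Computable.const _)
    refine ((ih.comp this).ball (N := fun q : List Bool × ℕ × List ℕ × ℕ => q.2.1)
      (Computable.fst.comp Computable.snd)).congr fun a => Iff.rfl

theorem KQ.iff {V : ℕ → ℕ → Prop} (σ : List Bool) (n : ℕ) : ∀ b ys c, KQ V n (σ, b, ys, c) ↔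
    ∀ zs : List ℕ, zs.length = n → zs.Pairwise (· < ·) → (∀ z ∈ zs, z < b) →
      V (Encodable.encode (zs ++ ys)) (c + zs.countP fun z => σ[z]?.getD false) := by
  induction n with
  | zero =>
    intro b ys c
    simp only [KQ]
    constructor
    · intro h zs hz _ _
      rw [List.length_eq_zero_iff] at hz
      subst hz
      simpa using h
    · intro h
      simpa using h [] rfl (by simp) (by simp)
  | succ n ih =>
    intro b ys c
    simp only [KQ, ih]
    constructor
    · intro h zs hz hp hb
      obtain ⟨zs', y, rfl⟩ : ∃ zs' y, zs = zs' ++ [y] := by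
        have : zs ≠ [] := by rintro rfl; simp at hz
        exact ⟨_, _, (List.dropLast_append_getLast this).symm⟩
      rw [List.pairwise_append] at hp
      have := h y (hb y (by simp)) zs' (by simpa using hz) hp.1 (fun z hz => hp.2.2 z hz y (by simp))
      rw [List.append_assoc, List.countP_append]
      convert this using 1
      · simp
      · cases h : σ[y]?.getD false <;> simp [h, List.countP_cons] <;> omega
    · intro h y hy zs hz hp hb
      have := h (zs ++ [y]) (by simpa using hz)
        (List.pairwise_append.2 ⟨hp, by simp, by simpa using hb⟩)
        (by
          intro z hz
          rcases List.mem_append.1 hz with hz | hz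
          · exact (hb z hz).trans hy
          · simp at hz; omega)
      rw [List.append_assoc, List.countP_append] at this
      convert this using 1
      · simp
      · cases h : σ[y]?.getD false <;> simp [h, List.countP_cons] <;> omega

theorem kencode (x : Finset ℕ) : Encodable.encode x = Encodable.encode (x.sort (· ≤ ·)) := by
  rfl

theorem KEmb.ce {B : ℕ → Bool} {T : List Bool → Prop} (hT : KCE B T) (m : ℕ) :
    KCE B (KEmb T m fun _ => True) := by
  induction m with
  | zero => exact hT.congr fun _ => Iff.rfl
  | succ m ih =>
    have c : ∀ b : Bool, Computable fun p : List Bool × List Bool => p.1 ++ p.2 ++ [b] := fun b =>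
      Computable.list_append.comp (Computable.list_append.comp Computable.fst Computable.snd)
        (Computable.const _)
    exact (((ih.comp (c false)).and (ih.comp (c true))).ex).congr fun σ => by simp [KEmb]

/-- Kummer's cardinality theorem (as used in the paper).  Fix `k ≥ 2` and `A, B ⊆ ℕ`.
Suppose there is a uniformly `B`-c.e. family (given by a computable monotone
enumeration operator `W`, with indices produced computably from each `(k-1)`-element
set `x`, here absorbed into `W` via the code of `x`) such that for every
`(k-1)`-element `x ⊆ ℕ`, the `B`-c.e. set assigned to `x` is a proper subset of
`{0,…,k-1}` containing `|x ∩ A|`.  Then `A` is computable from `B`. -/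
theorem stmt14 (k : ℕ) (hk : 2 ≤ k) (A B : ℕ → Bool)
    (W : List ℕ → ℕ → ℕ → Bool)
    (hWcomp : Computable fun p : List ℕ × ℕ × ℕ => W p.1 p.2.1 p.2.2)
    (hWmono : ∀ l₁ l₂ e c, l₁ <+: l₂ → W l₁ e c = true → W l₂ e c = true)
    (hWsub : ∀ x : Finset ℕ, x.card = k - 1 →
      ∀ c ∈ WSet W B (Encodable.encode x), c < k)
    (hWproper : ∀ x : Finset ℕ, x.card = k - 1 →
      ∃ c < k, c ∉ WSet W B (Encodable.encode x))
    (hWcard : ∀ x : Finset ℕ, x.card = k - 1 →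
      (x.filter fun a => A a = true).card ∈ WSet W B (Encodable.encode x)) :
    ∃ Ξ : TuringFunctional, Ξ.evalsTo (bc B) (bc A) := by
  classical
  set V : ℕ → ℕ → Prop := fun e c => c ∈ WSet W B e with hV
  set T : List Bool → Prop := fun σ => KQ V (k-1) (σ, σ.length, [], 0) with hTdef
  have hVce : KCE B fun p : ℕ × ℕ => V p.1 p.2 := by
    refine ⟨fun l p => W l p.1 p.2, hWcomp, fun l l' p => hWmono l l' p.1 p.2, fun p => Iff.rfl⟩
  have hTce : KCE B T := by
    refine (KQ.ce hVce (k-1)).comp (f := fun σ : List Bool => (σ, σ.length, [], 0)) ?_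
    exact Computable.id.pair (Computable.list_length.pair (Computable.const _))
  have hTiff : ∀ σ, T σ ↔ ∀ x : Finset ℕ, x.card = k - 1 → (∀ p ∈ x, p < σ.length) →
      (x.filter fun p => σ[p]? = some true).card ∈ WSet W B (Encodable.encode x) := by
    intro σ
    have cnt : ∀ x : Finset ℕ, (x.sort (· ≤ ·)).countP (fun z => σ[z]?.getD false) =
        (x.filter fun p => σ[p]? = some true).card := by
      intro x
      rw [Finset.card_def, Finset.filter_val, ← Multiset.countP_eq_card_filter]
      conv_rhs => rw [← Finset.sort_eq x (· ≤ ·)]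
      rw [Multiset.coe_countP]
      congr 1
      funext z
      rcases σ[z]? with _ | b
      · simp
      · cases b <;> simp
    rw [hTdef]
    simp only [KQ.iff, hV, List.append_nil, Nat.zero_add]
    constructor
    · intro h x hx hlt
      have := h (x.sort (· ≤ ·)) (by simpa using hx) (Finset.sortedLT_sort x).pairwise
        (by simpa using hlt)
      rw [cnt] at this
      rwa [kencode]
    · intro h zs hz hp hlt
      have hs : zs.toFinset.sort (· ≤ ·) = zs :=
        (List.toFinset_sort (· ≤ ·) hp.nodup).2 (hp.imp le_of_lt)
      have := h zs.toFinset (by rw [List.toFinset_card_of_nodup hp.nodup, hz]) (by simpa using hlt)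
      rw [← cnt, kencode, hs] at this
      exact this
  have hT : ∀ σ u, T (σ ++ u) → T σ := by
    intro σ u h
    rw [hTiff] at h ⊢
    intro x hx hlt
    have := h x hx (fun p hp => by have := hlt p hp; simp; omega)
    rwa [Finset.filter_congr (q := fun p => σ[p]? = some true)] at this
    intro p hp
    rw [List.getElem?_append_left (hlt p hp)]
  have hTA : ∀ l, T (kpre A l) := by
    intro l
    rw [hTiff]
    intro x hx hlt
    have := hWcard x hx
    rwa [Finset.filter_congr (q := fun p => (kpre A l)[p]? = some true)] at this
    intro p hp
    have := hlt p hp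
    simp [kpre] at this
    simp [kpre, this]
  -- a bound on the depth of embedded binary trees
  obtain ⟨M, hM⟩ : ∃ M, ¬ KEmb T M (fun _ => True) [] := by
    obtain ⟨M, hM⟩ := KEmb.config hT _ (k-1) (k-1) rfl
    refine ⟨M, fun h => ?_⟩
    rcases hM _ _ h with ⟨x, hx, -, hr⟩ | ⟨x, hx, -, hr⟩
    · obtain ⟨c, hc, hn⟩ := hWproper x hx
      obtain ⟨ρ, hρ, -, hlt, hcard⟩ := hr (k - 1 - c) (by omega)
      have := (hTiff ρ).1 hρ x hx hlt
      have hsum := Finset.card_filter_add_card_filter_not (s := x) (fun p => ρ[p]? = some true)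
      rw [Finset.filter_congr (p := fun p => ¬ ρ[p]? = some true)
        (q := fun p => ρ[p]? = some false), hcard, hx] at hsum
      · apply hn
        convert this using 1
        omega
      · intro p hp
        rw [List.getElem?_eq_getElem (hlt p hp)]
        simp
    · obtain ⟨c, hc, hn⟩ := hWproper x hx
      obtain ⟨ρ, hρ, -, hlt, hcard⟩ := hr c (by omega)
      have := (hTiff ρ).1 hρ x hx hlt
      rw [hcard] at this
      exact hn this
  -- the stable rank along `A`
  obtain ⟨m, hm, l0, hl0⟩ : ∃ m, (∀ l, KEmb T m (fun _ => True) (kpre A l)) ∧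
      ∃ l0, ¬ KEmb T (m+1) (fun _ => True) (kpre A l0) := by
    by_contra hcon
    push Not at hcon
    have : ∀ m l, KEmb T m (fun _ => True) (kpre A l) := by
      intro m
      induction m with
      | zero => exact hTA
      | succ m ih => exact hcon m ih
    exact hM (this M 0)
  have huniq := KEmb.unique hT A m l0 hm hl0
  have key : ∀ b n, A n = b ↔ ∃ u : List Bool, KEmb T m (fun _ => True) (kpre A l0 ++ u) ∧
      decide ((kpre A l0 ++ u)[n]? = some b) = true := by
    intro b n
    have hk : ∀ j, kpre A l0 ++ (List.range j).map (fun i => A (l0 + i)) = kpre A (l0 + j) := by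
      intro j; simp [kpre, List.range_add]
    constructor
    · intro h
      refine ⟨(List.range (n+1)).map (fun i => A (l0 + i)), ?_, ?_⟩
      · rw [hk]; exact hm _
      · rw [hk, decide_eq_true_eq]
        simp [kpre, h, show n < l0 + (n+1) by omega]
    · rintro ⟨u, hu, hd⟩
      have h1 := huniq u hu u.length le_rfl
      rw [List.take_length] at h1
      rw [h1, hk, decide_eq_true_eq, List.getElem?_eq_some_iff] at hd
      obtain ⟨_, h3⟩ := hd
      simpa [kpre] using h3
  have ce : ∀ b, KCE B fun n => A n = b := by
    intro b
    have c1 : Computable fun p : ℕ × List Bool => kpre A l0 ++ p.2 :=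
      Computable.list_append.comp (Computable.const _) Computable.snd
    have c2 : Computable fun p : ℕ × List Bool => decide ((kpre A l0 ++ p.2)[p.1]? = some b) :=
      (Primrec.eq (α := Option Bool)).decide.to_comp.comp
        (Computable.list_getElem?.comp c1 Computable.fst) (Computable.const _)
    exact ((((KEmb.ce hTce m).comp c1).and (KCE.dec c2)).ex).congr fun n => key b n
  exact KCE.turing (ce true) (ce false)
end

section
/- (Squashing Theorem) Let P and Q be total problems on Cantor space (every X ∈ 2^ω is an instance), and suppose P has finite tolerance: there is a Turing functional Θ such that whenever B₁, B₂ ∈ 2^ω agree above m and S₁ is a P-solution to B₁, then Θ(S₁, m) is a P-solution to B₂. If the pair ⟨Q, P⟩ is strongly Weihrauch reducible to P (there are functionals Φ, Ψ such that for instances (A, B) of (Q, P), Φ(A, B) is an instance of P and Ψ maps any P-solution of Φ(A,B) to a pair of solutions for A and B), then the countable parallelization Q^ω is strongly Weihrauch reducible to P: there are functionals Φ*, Ψ* such that for every sequence ⟨Aᵢ⟩ of Q-instances, Φ*(⟨Aᵢ⟩) is a P-instance, and from any P-solution T of it, Ψ*(T) is a sequence ⟨Sᵢ⟩ with each Sᵢ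 a Q-solution to Aᵢ. -/
/-- Join of a sequence of sets (points of Cantor space) into one oracle. -/
def seqJoinB (A : ℕ → ℕ → Bool) : ℕ → ℕ := fun n => Bool.toNat (A n.unpair.1 n.unpair.2)


namespace Squash

/-- Collect the values of a partial function up to bound `k`, stopping at the first gap. -/
def pf (g : ℕ → Option ℕ) (k : ℕ) : List ℕ :=
  Nat.rec (motive := fun _ => List ℕ) []
    (fun _ p => Option.casesOn (motive := fun _ => List ℕ) (g p.length) p (fun v => p ++ [v])) k

lemma pf_succ (g : ℕ → Option ℕ) (k : ℕ) :
    pf g (k + 1) = Option.casesOn (motive := fun _ => List ℕ) (g (pf g k).length) (pf g k)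
      (fun v => pf g k ++ [v]) := rfl

lemma pf_get {g : ℕ → Option ℕ} {k i a : ℕ} (h : (pf g k)[i]? = some a) : g i = some a := by
  induction k with
  | zero => simp [pf] at h
  | succ k ih =>
    rw [pf_succ] at h
    rcases hg : g (pf g k).length with _ | v
    · rw [hg] at h; exact ih h
    · rw [hg] at h
      simp only [] at h
      rw [List.getElem?_append] at h
      split_ifs at h with h1
      · exact ih h
      · rcases hi : i - (pf g k).length with _ | n
        · rw [hi] at h
          have : i = (pf g k).length := by omega
          rw [this, hg]; simpa using h
        · rw [hi] at h; simp at h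

lemma pf_length_le (g : ℕ → Option ℕ) (k : ℕ) : (pf g k).length ≤ k := by
  induction k with
  | zero => simp [pf]
  | succ k ih =>
    rw [pf_succ]
    rcases hg : g (pf g k).length with _ | v
    · simp only []; omega
    · simp; omega

lemma pf_len {g : ℕ → Option ℕ} {n k : ℕ} (h : ∀ i < n, ∃ a, g i = some a) (hk : n ≤ k) :
    n ≤ (pf g k).length := by
  induction k generalizing n with
  | zero => omega
  | succ k ih =>
    rw [pf_succ]
    have h1 : min n k ≤ (pf g k).length :=
      ih (fun i hi => h i (by omega)) (by omega)
    have h2 := pf_length_le g k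
    rcases hg : g (pf g k).length with _ | v
    · simp only []
      by_contra hc
      obtain ⟨a, ha⟩ := h (pf g k).length (by omega)
      rw [hg] at ha; cases ha
    · simp; omega

lemma prefix_of {l₁ l₂ : List ℕ} (h : ∀ i a : ℕ, l₁[i]? = some a → l₂[i]? = some a) : l₁ <+: l₂ := by
  rw [List.prefix_iff_getElem?]
  intro i hi
  exact h i _ (List.getElem?_eq_getElem hi)

lemma prefix_get {l₁ l₂ : List ℕ} (h : l₁ <+: l₂) {i a : ℕ} (hi : l₁[i]? = some a) :
    l₂[i]? = some a := by
  obtain ⟨h1, h2⟩ := List.getElem?_eq_some_iff.1 hi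
  rw [List.prefix_iff_getElem?] at h
  rw [h i h1, h2]

lemma get_of_lt {l : List ℕ} {i : ℕ} (h : i < l.length) : ∃ a, l[i]? = some a :=
  ⟨_, List.getElem?_eq_getElem h⟩

lemma lt_of_get {l : List ℕ} {i a : ℕ} (h : l[i]? = some a) : i < l.length :=
  (List.getElem?_eq_some_iff.1 h).1

lemma pf_mono {g g' : ℕ → Option ℕ} {k k' : ℕ} (h : ∀ i a, g i = some a → g' i = some a)
    (hk : k ≤ k') : pf g k <+: pf g' k' := by
  apply prefix_of
  intro i a hi
  have hl : (pf g k).length ≤ (pf g' k').length := by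
    apply pf_len
    · intro j hj
      obtain ⟨b, hb⟩ := get_of_lt hj
      exact ⟨b, h _ _ (pf_get hb)⟩
    · exact (pf_length_le g k).trans hk
  obtain ⟨b, hb⟩ := get_of_lt (lt_of_lt_of_le (lt_of_get hi) hl)
  have h1 := pf_get hb
  have h2 := h _ _ (pf_get hi)
  rw [hb, ← h1, h2]

lemma pf_computable {α : Type*} [Primcodable α] {g : α → ℕ → Option ℕ} {k : α → ℕ}
    (hg : Computable₂ g) (hk : Computable k) : Computable fun a => pf (g a) (k a) := by
  unfold pf
  refine Computable.nat_rec (h := fun a (q : ℕ × List ℕ) =>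
    Option.casesOn (motive := fun _ => List ℕ) (g a q.2.length) q.2 (fun v => q.2 ++ [v]))
    hk (Computable.const []) ?_
  have e1 : Computable fun x : α × (ℕ × List ℕ) => x.2.2 :=
    Computable.snd.comp Computable.snd
  refine Computable.option_casesOn (hg.comp Computable.fst (Computable.list_length.comp e1)) e1 ?_
  exact Computable.list_concat.comp (e1.comp Computable.fst) Computable.snd

/-- `L` is an initial segment of `X`. -/
def Sub (L : List ℕ) (X : ℕ → ℕ) : Prop := ∀ i a, L[i]? = some a → X i = a

/-- Initial segment of length `k`. -/
def tab (k : ℕ) (X : ℕ → ℕ) : List ℕ := (List.range k).map X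

@[simp] lemma tab_length (k X) : (tab k X).length = k := by simp [tab]

lemma tab_get {k i a : ℕ} {X : ℕ → ℕ} : (tab k X)[i]? = some a ↔ i < k ∧ X i = a := by
  unfold tab
  rw [List.getElem?_eq_some_iff]
  simp

lemma tab_sub (k X) : Sub (tab k X) X := fun _ _ h => (tab_get.1 h).2

lemma tab_pre {k : ℕ} {L : List ℕ} {X : ℕ → ℕ} (h : Sub L X) (hk : k ≤ L.length) :
    tab k X <+: L := by
  apply prefix_of
  intro i a hi
  obtain ⟨h1, h2⟩ := tab_get.1 hi
  obtain ⟨b, hb⟩ := get_of_lt (lt_of_lt_of_le h1 hk)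
  rw [hb, ← h2, h _ _ hb]

lemma sub_tab {L : List ℕ} {X : ℕ → ℕ} (h : Sub L X) {k : ℕ} (hk : L.length ≤ k) :
    L <+: tab k X := by
  apply prefix_of
  intro i a hi
  exact tab_get.2 ⟨lt_of_lt_of_le (lt_of_get hi) hk, h _ _ hi⟩

lemma Sub.mono {L L' : List ℕ} {X : ℕ → ℕ} (h : Sub L' X) (hl : L <+: L') : Sub L X :=
  fun i a hi => h i a (prefix_get hl hi)

/-- `F` maps longer and longer initial segments of `X` to those of `Y`. -/
def Appr (F : List ℕ → List ℕ) (X Y : ℕ → ℕ) : Prop :=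
  (∀ L, Sub L X → Sub (F L) Y) ∧
  ∀ n, ∃ k, ∀ L, Sub L X → k ≤ L.length → n ≤ (F L).length

lemma Appr.comp {F G : List ℕ → List ℕ} {X Y Z : ℕ → ℕ} (hG : Appr G Y Z) (hF : Appr F X Y) :
    Appr (fun L => G (F L)) X Z := by
  refine ⟨fun L hL => hG.1 _ (hF.1 _ hL), fun n => ?_⟩
  obtain ⟨k, hk⟩ := hG.2 n
  obtain ⟨k', hk'⟩ := hF.2 k
  exact ⟨k', fun L hL h => hk _ (hF.1 _ hL) (hk' _ hL h)⟩

/-- apply a functional to a finite list -/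
def ap (Φ : TuringFunctional) (l : List ℕ) : List ℕ := pf (Φ.approx l) l.length

lemma ap_mono (Φ : TuringFunctional) {l l' : List ℕ} (h : l <+: l') : ap Φ l <+: ap Φ l' :=
  pf_mono (fun _ _ hi => Φ.mono h hi) h.length_le

lemma ap_length_le (Φ : TuringFunctional) (l : List ℕ) : (ap Φ l).length ≤ l.length :=
  pf_length_le _ _

lemma ap_computable (Φ : TuringFunctional) : Computable (ap Φ) :=
  pf_computable Φ.computable Computable.list_length

lemma ap_appr {Φ : TuringFunctional} {X Y : ℕ → ℕ} (h : Φ.evalsTo X Y) : Appr (ap Φ) X Y := by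
  have key : ∀ i, ∃ m, ∀ L, Sub L X → m ≤ L.length → Φ.approx L i = some (Y i) := by
    intro i
    obtain ⟨m, hm⟩ := h i
    exact ⟨m, fun L hL hk => Φ.mono (tab_pre hL hk) hm⟩
  refine ⟨?_, ?_⟩
  · intro L hL i a hi
    have h1 := pf_get hi
    obtain ⟨m, hm⟩ := key i
    have h2 := Φ.mono (sub_tab hL (le_max_left L.length m)) h1
    rw [hm _ (tab_sub _ _) (by simp)] at h2
    exact Option.some.inj h2
  · choose m hm using key
    intro n
    refine ⟨max n ((Finset.range n).sup m), fun L hL hk => pf_len ?_ (le_trans (le_max_left _ _) hk)⟩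
    intro i hi
    refine ⟨_, hm i L hL (le_trans ?_ ((le_max_right _ _).trans hk))⟩
    exact Finset.le_sup (f := m) (Finset.mem_range.2 hi)

/-- join of lists -/
def joinL (a b : List ℕ) : List ℕ :=
  pf (fun n => bif n % 2 == 0 then a[n / 2]? else b[n / 2]?) (a.length + b.length)

lemma joinL_mono {a b a' b' : List ℕ} (ha : a <+: a') (hb : b <+: b') :
    joinL a b <+: joinL a' b' := by
  apply pf_mono
  · intro i x
    cases h : i % 2 == 0
    · simpa using prefix_get hb
    · simpa using prefix_get ha
  · have := ha.length_le; have := hb.length_le; omega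

lemma joinL_sub {a b : List ℕ} {X Y : ℕ → ℕ} (ha : Sub a X) (hb : Sub b Y) :
    Sub (joinL a b) (join2 X Y) := by
  intro i x hi
  have h1 := pf_get hi
  unfold join2
  by_cases h : i % 2 = 0
  · simp only [h, if_true]; simp [h] at h1; exact ha _ _ h1
  · have h' : i % 2 = 1 := by omega
    simp only [h, if_false]; simp [h'] at h1; exact hb _ _ h1

lemma joinL_length {a b : List ℕ} {n : ℕ} (ha : n ≤ a.length) (hb : n ≤ b.length) :
    n ≤ (joinL a b).length := by
  apply pf_len
  · intro i hi
    cases h : i % 2 == 0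
    · simpa using get_of_lt (l := b) (i := i / 2) (by omega)
    · simpa using get_of_lt (l := a) (i := i / 2) (by omega)
  · omega

lemma even_comp : Computable fun n : ℕ => n % 2 == 0 :=
  (Primrec.beq.comp (Primrec.nat_mod.comp Primrec.id (Primrec.const 2)) (Primrec.const 0)).to_comp

lemma half_comp : Computable fun n : ℕ => n / 2 :=
  (Primrec.nat_div.comp Primrec.id (Primrec.const 2)).to_comp

lemma add_comp : Computable₂ fun a b : ℕ => a + b := Primrec.nat_add.to_comp

lemma joinL_computable : Computable₂ joinL := by
  unfold joinL
  refine pf_computable (α := List ℕ × List ℕ)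
    (g := fun p n => bif n % 2 == 0 then p.1[n / 2]? else p.2[n / 2]?)
    (k := fun p => p.1.length + p.2.length) ?_ ?_
  · refine Computable.cond (even_comp.comp Computable.snd) ?_ ?_
    · exact Computable.list_getElem?.comp (Computable.fst.comp Computable.fst)
        (half_comp.comp Computable.snd)
    · exact Computable.list_getElem?.comp (Computable.snd.comp Computable.fst)
        (half_comp.comp Computable.snd)
  · exact add_comp.comp (Computable.list_length.comp Computable.fst)
      (Computable.list_length.comp Computable.snd)

/-- join of a list with a constant -/
def jm (a : List ℕ) (m : ℕ) : List ℕ :=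
  pf (fun n => bif n % 2 == 0 then a[n / 2]? else some m) a.length

lemma jm_mono {a a' : List ℕ} (m : ℕ) (ha : a <+: a') : jm a m <+: jm a' m := by
  apply pf_mono
  · intro i x
    cases h : i % 2 == 0
    · simp
    · simpa using prefix_get ha
  · exact ha.length_le

lemma jm_appr (X : ℕ → ℕ) (m : ℕ) : Appr (fun a => jm a m) X (join2 X fun _ => m) := by
  refine ⟨fun a ha i x hi => ?_, fun n => ⟨n, fun a ha hn => pf_len (fun i hi => ?_) hn⟩⟩
  · have h1 := pf_get hi
    unfold join2
    by_cases h : i % 2 = 0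
    · simp only [h, if_true]; simp [h] at h1; exact ha _ _ h1
    · have h' : i % 2 = 1 := by omega
      simp only [h, if_false]; simpa [h'] using h1
  · cases h : i % 2 == 0
    · simp
    · simpa using get_of_lt (l := a) (i := i / 2) (by omega)

lemma jm_computable : Computable₂ jm := by
  unfold jm
  refine pf_computable (α := List ℕ × ℕ)
    (g := fun p n => bif n % 2 == 0 then p.1[n / 2]? else some p.2)
    (k := fun p => p.1.length) ?_ (Computable.list_length.comp Computable.fst)
  refine Computable.cond (even_comp.comp Computable.snd) ?_ ?_
  · exact Computable.list_getElem?.comp (Computable.fst.comp Computable.fst)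
      (half_comp.comp Computable.snd)
  · exact Computable.option_some.comp (Computable.snd.comp Computable.fst)

/-- every other entry, starting from `c` -/
def part (c : ℕ) (L : List ℕ) : List ℕ := pf (fun n => L[2 * n + c]?) L.length

lemma part_mono (c : ℕ) {a a' : List ℕ} (ha : a <+: a') : part c a <+: part c a' :=
  pf_mono (fun _ _ hi => prefix_get ha hi) ha.length_le

lemma part_appr (c : ℕ) (X Y : ℕ → ℕ) (h : ∀ n, X (2 * n + c) = Y n) : Appr (part c) X Y := by
  refine ⟨fun a ha i x hi => ?_, fun n => ⟨2 * n + c, fun a ha hn => pf_len (fun i hi => ?_) ?_⟩⟩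
  · have h1 := pf_get hi
    rw [← h]; exact ha _ _ h1
  · exact get_of_lt (by omega)
  · omega

lemma part_computable (c : ℕ) : Computable (part c) := by
  unfold part
  refine pf_computable (g := fun (L : List ℕ) n => L[2 * n + c]?) ?_ Computable.list_length
  refine Computable.list_getElem?.comp Computable.fst ?_
  exact (Primrec.nat_add.comp (Primrec.nat_mul.comp (Primrec.const 2) Primrec.id)
    (Primrec.const c)).to_comp.comp Computable.snd

/-- column of a list -/
def col (L : List ℕ) (i : ℕ) : List ℕ := pf (fun j => L[Nat.pair i j]?) L.length

lemma col_mono (i : ℕ) {a a' : List ℕ} (ha : a <+: a') : col a i <+: col a' i :=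
  pf_mono (fun _ _ hi => prefix_get ha hi) ha.length_le

lemma col_appr (i : ℕ) (A : ℕ → ℕ → Bool) :
    Appr (fun L => col L i) (seqJoinB A) (bc (A i)) := by
  refine ⟨fun a ha j x hi => ?_, fun n => ⟨Nat.pair i n, fun a ha hn => pf_len (fun j hj => ?_) ?_⟩⟩
  · have h0 : a[Nat.pair i j]? = some x := pf_get (g := fun j => a[Nat.pair i j]?) hi
    have h1 := ha _ _ h0
    simpa [seqJoinB, bc] using h1
  · exact get_of_lt (lt_of_lt_of_le (Nat.pair_lt_pair_right _ hj) hn)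
  · exact (Nat.right_le_pair _ _).trans hn

lemma col_computable : Computable₂ col := by
  unfold col
  refine pf_computable (α := List ℕ × ℕ) (g := fun p j => p.1[Nat.pair p.2 j]?)
    (k := fun p => p.1.length) ?_ (Computable.list_length.comp Computable.fst)
  exact Computable.list_getElem?.comp (Computable.fst.comp Computable.fst)
    (Primrec₂.natPair.to_comp.comp (Computable.snd.comp Computable.fst) Computable.snd)

/-- overwrite by zeros below `m` -/
def modL (m : ℕ) (L : List ℕ) : List ℕ :=
  pf (fun n => bif decide (n < m) then some 0 else L[n]?) (m + L.length)

lemma modL_mono (m : ℕ) {a a' : List ℕ} (ha : a <+: a') : modL m a <+: modL m a' := by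
  apply pf_mono
  · intro i x
    by_cases h : i < m
    · simp [h]
    · simpa [h] using prefix_get ha
  · have := ha.length_le; omega

lemma modL_length_left (m : ℕ) (a : List ℕ) : m ≤ (modL m a).length :=
  pf_len (fun i hi => ⟨0, by simp [hi]⟩) (by omega)

lemma modL_length_right (m : ℕ) (a : List ℕ) : a.length ≤ (modL m a).length := by
  refine pf_len (fun i hi => ?_) (by omega)
  by_cases h : i < m
  · simp [h]
  · simp [h, hi]

lemma modL_get {m : ℕ} {a : List ℕ} {i x : ℕ} (h : (modL m a)[i]? = some x) :
    (i < m ∧ x = 0) ∨ (m ≤ i ∧ a[i]? = some x) := by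
  have h1 := pf_get h
  by_cases hi : i < m
  · simp [hi] at h1; exact Or.inl ⟨hi, h1.symm⟩
  · simp only [hi, decide_false, cond_false] at h1; exact Or.inr ⟨by omega, h1⟩

lemma modL_nil (m : ℕ) (a : List ℕ) : modL m [] <+: modL m a := modL_mono m ⟨a, rfl⟩

lemma modL_computable : Computable₂ modL := by
  unfold modL
  refine pf_computable (α := ℕ × List ℕ)
    (g := fun p n => bif decide (n < p.1) then some 0 else p.2[n]?)
    (k := fun p => p.1 + p.2.length) ?_ ?_
  · refine Computable.cond ?_ (Computable.const _) ?_
    · exact (Primrec.nat_lt.decide.to_comp).comp Computable.snd (Computable.fst.comp Computable.fst)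
    · exact Computable.list_getElem?.comp (Computable.snd.comp Computable.fst) Computable.snd
  · exact add_comp.comp Computable.fst (Computable.list_length.comp Computable.snd)

/-- the `j`-th binary string of length `k` -/
def bits (k j : ℕ) : List ℕ := pf (fun i => some (j / 2 ^ i % 2)) k

lemma pow_comp : Primrec₂ fun a b : ℕ => a ^ b := Primrec₂.unpaired'.1 Nat.Primrec.pow

lemma bits_computable : Computable₂ bits := by
  unfold bits
  refine pf_computable (α := ℕ × ℕ) (g := fun p i => some (p.2 / 2 ^ i % 2)) ?_ Computable.fst
  have : Primrec₂ fun (p : ℕ × ℕ) (i : ℕ) => some (p.2 / 2 ^ i % 2) :=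
    Primrec.option_some.comp (Primrec.nat_mod.comp (Primrec.nat_div.comp
      (Primrec.snd.comp Primrec.fst) (pow_comp.comp (Primrec.const 2) Primrec.snd))
      (Primrec.const 2))
  exact this.to_comp

lemma bits_get {k j i a : ℕ} (h : (bits k j)[i]? = some a) : j / 2 ^ i % 2 = a :=
  Option.some.inj (pf_get (g := fun i => some (j / 2 ^ i % 2)) h)

lemma bits_eq (X : ℕ → Bool) (k : ℕ) : ∃ j < 2 ^ k, bits k j = tab k (bc X) := by
  refine ⟨Nat.ofBits (fun i : Fin k => X i), Nat.ofBits_lt_two_pow _, ?_⟩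
  have hl : (bits k (Nat.ofBits fun i : Fin k => X i)).length = k :=
    le_antisymm (pf_length_le _ _) (pf_len (fun _ _ => ⟨_, rfl⟩) le_rfl)
  refine List.IsPrefix.eq_of_length ?_ (by simp [hl])
  apply prefix_of
  intro i a h
  have hi := lt_of_get h
  rw [hl] at hi
  refine tab_get.2 ⟨hi, ?_⟩
  have h1 := bits_get h
  rw [← Nat.toNat_testBit, Nat.testBit_ofBits_lt _ _ hi] at h1
  exact h1

lemma bits_sub (k j : ℕ) : Sub (bits k j) (bc fun i => j.testBit i) := by
  intro i a h
  have h1 := bits_get h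
  rw [← Nat.toNat_testBit] at h1
  exact h1

lemma bits_length (k j : ℕ) : (bits k j).length = k :=
  le_antisymm (pf_length_le _ _) (pf_len (fun _ _ => ⟨_, rfl⟩) le_rfl)

/-- all binary strings of length `k` give at least `n` outputs -/
def good (Φ : TuringFunctional) (n k : ℕ) : Bool :=
  Nat.rec (motive := fun _ => Bool) true
    (fun j acc => acc && decide (n ≤ (ap Φ (bits k j)).length)) (2 ^ k)

lemma good_computable (Φ : TuringFunctional) : Computable₂ (good Φ) := by
  unfold good
  refine Computable.nat_rec (α := ℕ × ℕ) (f := fun p => 2 ^ p.2) (g := fun _ => true)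
    (h := fun p q => q.2 && decide (p.1 ≤ (ap Φ (bits p.2 q.1)).length)) ?_ (Computable.const _) ?_
  · exact (pow_comp.comp (Primrec.const 2) Primrec.snd).to_comp
  · refine Primrec.and.to_comp.comp (Computable.snd.comp Computable.snd) ?_
    refine (Primrec.nat_le.decide.to_comp).comp (Computable.fst.comp Computable.fst) ?_
    refine Computable.list_length.comp ((ap_computable Φ).comp ?_)
    exact bits_computable.comp (Computable.snd.comp Computable.fst)
      (Computable.fst.comp Computable.snd)

lemma good_iff (Φ : TuringFunctional) (n k : ℕ) :
    good Φ n k = true ↔ ∀ X : ℕ → Bool, n ≤ (ap Φ (tab k (bc X))).length := by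
  have aux : ∀ N, (Nat.rec (motive := fun _ => Bool) true
      (fun j acc => acc && decide (n ≤ (ap Φ (bits k j)).length)) N : Bool) = true ↔
      ∀ j < N, n ≤ (ap Φ (bits k j)).length := by
    intro N
    induction N with
    | zero => simp
    | succ N ih =>
      simp only [Bool.and_eq_true, ih, decide_eq_true_eq, Nat.lt_succ_iff_lt_or_eq]
      constructor
      · rintro ⟨h1, h2⟩ j (hj | rfl)
        · exact h1 j hj
        · exact h2
      · intro h
        exact ⟨fun j hj => h j (Or.inl hj), h N (Or.inr rfl)⟩
  unfold good
  rw [aux]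
  constructor
  · intro h X
    obtain ⟨j, hj, e⟩ := bits_eq X k
    rw [← e]; exact h j hj
  · intro h j _
    refine (h fun i => j.testBit i).trans (ap_mono Φ ?_).length_le
    exact tab_pre (bits_sub k j) (bits_length k j).ge

lemma exists_good (Φ : TuringFunctional)
    (htot : ∀ X : ℕ → Bool, ∃ C : ℕ → Bool, Φ.evalsTo (bc X) (bc C)) (n : ℕ) :
    ∃ k, good Φ n k = true := by
  have hc : IsCompact (Set.univ : Set (ℕ → Bool)) := isCompact_univ
  suffices h : ∃ k, Set.univ ⊆ {X : ℕ → Bool | n ≤ (ap Φ (tab k (bc X))).length} by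
    obtain ⟨k, hk⟩ := h
    exact ⟨k, (good_iff _ _ _).2 fun X => hk (Set.mem_univ X)⟩
  refine hc.elim_directed_cover
    (fun k => {X : ℕ → Bool | n ≤ (ap Φ (tab k (bc X))).length}) ?_ ?_ ?_
  · intro k
    have hcont : Continuous fun (X : ℕ → Bool) (i : Fin k) => X i := by fun_prop
    have hopen := (isOpen_discrete {σ : Fin k → Bool |
      n ≤ (ap Φ (tab k (fun i => if h : i < k then (σ ⟨i, h⟩).toNat else 0))).length}).preimage hcont
    convert hopen using 1
    have key : ∀ X : ℕ → Bool, tab k (bc X) = tab k (fun i => if h : i < k then (X i).toNat else 0) := by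
      intro X
      unfold tab
      apply List.map_congr_left
      intro i hi
      simp [List.mem_range.1 hi, bc]
    ext X
    simp only [Set.mem_ofPred_eq, Set.mem_preimage, key]
  · intro X _
    obtain ⟨C, hC⟩ := htot X
    obtain ⟨k, hk⟩ := (ap_appr hC).2 n
    exact Set.mem_iUnion.2 ⟨k, hk _ (tab_sub _ _) (by simp)⟩
  · refine directed_of_isDirected_le fun k k' hkk X hX => ?_
    exact le_trans hX (ap_mono Φ (tab_pre (tab_sub _ _) (by simpa using hkk))).length_le

lemma exists_use (Φ : TuringFunctional)
    (htot : ∀ X : ℕ → Bool, ∃ C : ℕ → Bool, Φ.evalsTo (bc X) (bc C)) :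
    ∃ u : ℕ → ℕ, Computable u ∧ Monotone u ∧ (∀ n, n ≤ u n) ∧
      ∀ n L (X : ℕ → Bool), Sub L (bc X) → u n ≤ L.length → n ≤ (ap Φ L).length := by
  have hg := exists_good Φ htot
  have h4 : ∀ n (X : ℕ → Bool), n ≤ (ap Φ (tab (Nat.find (hg n)) (bc X))).length :=
    fun n => (good_iff _ _ _).1 (Nat.find_spec (hg n))
  refine ⟨fun n => Nat.find (hg n), ?_, ?_, ?_, ?_⟩
  · have h1 : Partrec fun n => Nat.rfind (fun k => Part.some (good Φ n k)) :=
      Partrec.rfind (good_computable Φ).partrec₂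
    refine h1.of_eq fun n => ?_
    apply Part.eq_some_iff.2
    refine Nat.mem_rfind.2 ⟨?_, fun {m} hm => ?_⟩
    · simpa using (Nat.find_spec (hg n)).symm
    · simpa using Nat.find_min (hg n) hm
  · intro n n' hn
    apply Nat.find_min'
    rw [good_iff]
    exact fun X => hn.trans (h4 n' X)
  · intro n
    have := (h4 n (fun _ => false)).trans (ap_length_le _ _)
    simpa using this
  · intro n L X hL hl
    exact (h4 n X).trans (ap_mono Φ (tab_pre hL hl)).length_le

/-- nested approximations, `H d e` approximates the instance with index `d - e` -/
def H (Φ : TuringFunctional) (m : ℕ → ℕ) (l : List ℕ) (d e : ℕ) : List ℕ :=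
  Nat.rec (motive := fun _ => List ℕ) (modL (m d) [])
    (fun e p => modL (m (d - (e + 1))) (ap Φ (joinL (col l (d - (e + 1))) p))) e

/-- depth `e` approximation of the instance with index `i` -/
def w (Φ : TuringFunctional) (m : ℕ → ℕ) (l : List ℕ) (i e : ℕ) : List ℕ := H Φ m l (i + e) e

lemma w_zero (Φ m l i) : w Φ m l i 0 = modL (m i) [] := rfl

lemma w_succ (Φ m l i e) :
    w Φ m l i (e + 1) = modL (m i) (ap Φ (joinL (col l i) (w Φ m l (i + 1) e))) := by
  have h1 : i + (e + 1) - (e + 1) = i := by omega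
  have h2 : i + (e + 1) = i + 1 + e := by omega
  show modL (m (i + (e + 1) - (e + 1))) (ap Φ (joinL (col l (i + (e + 1) - (e + 1)))
    (H Φ m l (i + (e + 1)) e))) = _
  rw [h1, h2]; rfl

lemma w_mono (Φ : TuringFunctional) (m : ℕ → ℕ) {l l' : List ℕ} (h : l <+: l') {e e' : ℕ}
    (he : e ≤ e') (i : ℕ) : w Φ m l i e <+: w Φ m l' i e' := by
  induction e' generalizing i e with
  | zero =>
    obtain rfl : e = 0 := by omega
    rw [w_zero, w_zero]
  | succ e' ih =>
    rcases e with _ | e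
    · rw [w_zero, w_succ]; exact modL_nil _ _
    · rw [w_succ, w_succ]
      exact modL_mono _ (ap_mono _ (joinL_mono (col_mono _ h) (ih (by omega) _)))

lemma H_computable (Φ : TuringFunctional) {m : ℕ → ℕ} (hm : Computable m) :
    Computable fun l : List ℕ => w Φ m l 0 l.length := by
  have hsub : Computable₂ fun a b : ℕ => a - b := Primrec.nat_sub.to_comp
  have hlen : Computable fun l : List ℕ => 0 + l.length :=
    add_comp.comp (Computable.const 0) Computable.list_length
  unfold w H
  refine Computable.nat_rec (f := List.length) (g := fun l => modL (m (0 + l.length)) [])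
    (h := fun l q => modL (m (0 + l.length - (q.1 + 1)))
      (ap Φ (joinL (col l (0 + l.length - (q.1 + 1))) q.2))) Computable.list_length ?_ ?_
  · exact modL_computable.comp (hm.comp hlen) (Computable.const [])
  · have hd : Computable fun x : List ℕ × (ℕ × List ℕ) => 0 + x.1.length - (x.2.1 + 1) :=
      hsub.comp (hlen.comp Computable.fst)
        (Computable.succ.comp (Computable.fst.comp Computable.snd))
    refine modL_computable.comp (hm.comp hd) ((ap_computable Φ).comp ?_)
    exact joinL_computable.comp (col_computable.comp Computable.fst hd)
      (Computable.snd.comp Computable.snd)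

/-- iterated solutions -/
def tt (Θ Ψ : TuringFunctional) (m : ℕ → ℕ) (l : List ℕ) (i : ℕ) : List ℕ :=
  Nat.rec (motive := fun _ => List ℕ) l
    (fun i p => part 1 (ap Ψ (ap Θ (jm p (m i))))) i

lemma tt_succ (Θ Ψ m l i) :
    tt Θ Ψ m l (i + 1) = part 1 (ap Ψ (ap Θ (jm (tt Θ Ψ m l i) (m i)))) := rfl

/-- extracted solution -/
def ss (Θ Ψ : TuringFunctional) (m : ℕ → ℕ) (l : List ℕ) (i : ℕ) : List ℕ :=
  part 0 (ap Ψ (ap Θ (jm (tt Θ Ψ m l i) (m i))))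

lemma tt_mono (Θ Ψ : TuringFunctional) (m : ℕ → ℕ) {l l' : List ℕ} (h : l <+: l') (i : ℕ) :
    tt Θ Ψ m l i <+: tt Θ Ψ m l' i := by
  induction i with
  | zero => exact h
  | succ i ih =>
    rw [tt_succ, tt_succ]
    exact part_mono _ (ap_mono _ (ap_mono _ (jm_mono _ ih)))

lemma ss_mono (Θ Ψ : TuringFunctional) (m : ℕ → ℕ) {l l' : List ℕ} (h : l <+: l') (i : ℕ) :
    ss Θ Ψ m l i <+: ss Θ Ψ m l' i :=
  part_mono _ (ap_mono _ (ap_mono _ (jm_mono _ (tt_mono _ _ _ h i))))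

lemma tt_computable (Θ Ψ : TuringFunctional) {m : ℕ → ℕ} (hm : Computable m) :
    Computable₂ (tt Θ Ψ m) := by
  unfold tt
  refine Computable.nat_rec (α := List ℕ × ℕ) (f := fun p => p.2) (g := fun p => p.1)
    (h := fun _ q => part 1 (ap Ψ (ap Θ (jm q.2 (m q.1))))) Computable.snd Computable.fst ?_
  refine (part_computable 1).comp ((ap_computable Ψ).comp ((ap_computable Θ).comp ?_))
  exact jm_computable.comp (Computable.snd.comp Computable.snd)
    (hm.comp (Computable.fst.comp Computable.snd))

lemma ss_computable (Θ Ψ : TuringFunctional) {m : ℕ → ℕ} (hm : Computable m) :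
    Computable₂ (ss Θ Ψ m) := by
  unfold ss
  refine (part_computable 0).comp ((ap_computable Ψ).comp ((ap_computable Θ).comp ?_))
  exact jm_computable.comp (tt_computable Θ Ψ hm) (hm.comp Computable.snd)

/-- The forward functional. -/
def fwd (Φ : TuringFunctional) {m : ℕ → ℕ} (hm : Computable m) : TuringFunctional where
  approx l n := (w Φ m l 0 l.length)[n]?
  computable := Computable.list_getElem?.comp ((H_computable Φ hm).comp Computable.fst)
    Computable.snd
  mono := fun h hi => prefix_get (w_mono Φ m h h.length_le 0) hi

/-- The backward functional. -/
def bwd (Θ Ψ : TuringFunctional) {m : ℕ → ℕ} (hm : Computable m) : TuringFunctional where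
  approx l n := (ss Θ Ψ m l n.unpair.1)[n.unpair.2]?
  computable := Computable.list_getElem?.comp
    ((ss_computable Θ Ψ hm).comp Computable.fst
      (Computable.fst.comp (Computable.unpair.comp Computable.snd)))
    (Computable.snd.comp (Computable.unpair.comp Computable.snd))
  mono := fun h hi => prefix_get (ss_mono Θ Ψ m h _) hi

/-- cutoff points -/
def cut (u : ℕ → ℕ) (k : ℕ) : ℕ := Nat.rec (motive := fun _ => ℕ) k (fun _ x => u x) k

lemma cut_eq (u : ℕ → ℕ) (k : ℕ) : cut u k = u^[k] k := by
  have : ∀ j, (Nat.rec (motive := fun _ => ℕ) k (fun _ x => u x) j : ℕ) = u^[j] k := by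
    intro j
    induction j with
    | zero => rfl
    | succ j ih => rw [Function.iterate_succ_apply', ← ih]
  exact this k

lemma cut_computable {u : ℕ → ℕ} (hu : Computable u) : Computable (cut u) := by
  unfold cut
  exact Computable.nat_rec (f := fun k => k) (g := fun k => k) (h := fun _ q => u q.2)
    Computable.id Computable.id (hu.comp (Computable.snd.comp Computable.snd))

lemma bc_inj {X : ℕ → Bool} {Y : ℕ → Bool} {n : ℕ} (h : bc X n = bc Y n) : X n = Y n :=
by
  unfold bc at h
  revert h
  cases X n <;> cases Y n <;> simp

end Squash

open Squash in
/-- The Squashing Theorem.  Let `P` and `Q` be total problems on Cantor space, and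
suppose `P` has finite tolerance via the functional `Θ`: whenever `B₁, B₂` agree above
`m` and `S₁` is a `P`-solution to `B₁`, then `Θ(S₁ ⊕ m)` is a `P`-solution to `B₂`.  If
`⟨Q, P⟩ ≤sW P` via functionals `Φ, Ψ` (where `Ψ` produces from any `P`-solution of
`Φ(A ⊕ B)` a joined pair of solutions for `A` and `B`), then `Q^ω ≤sW P`: there are
functionals `Φ*, Ψ*` such that for every sequence `⟨Aᵢ⟩` of instances, `Φ*(⟨Aᵢ⟩)` is an
instance of `P`, and from any `P`-solution `T` of it, `Ψ*(T)` is a sequence `⟨Sᵢ⟩` with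
each `Sᵢ` a `Q`-solution to `Aᵢ`. -/
theorem stmt17 (P Q : (ℕ → Bool) → (ℕ → Bool) → Prop)
    (hPtot : ∀ X, ∃ Y, P X Y) (hQtot : ∀ X, ∃ Y, Q X Y)
    (Θ : TuringFunctional)
    (hTol : ∀ B₁ B₂ : ℕ → Bool, ∀ m : ℕ, (∀ x, m ≤ x → B₁ x = B₂ x) →
      ∀ S₁, P B₁ S₁ →
        ∃ S₂, Θ.evalsTo (join2 (bc S₁) fun _ => m) (bc S₂) ∧ P B₂ S₂)
    (Φ Ψ : TuringFunctional)
    (hred : ∀ A B : ℕ → Bool, ∃ C : ℕ → Bool,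
      Φ.evalsTo (join2 (bc A) (bc B)) (bc C) ∧
      ∀ T : ℕ → Bool, P C T →
        ∃ SA SB : ℕ → Bool, Ψ.evalsTo (bc T) (join2 (bc SA) (bc SB)) ∧ Q A SA ∧ P B SB) :
    ∃ Φs Ψs : TuringFunctional, ∀ A : ℕ → ℕ → Bool,
      ∃ B : ℕ → Bool, Φs.evalsTo (seqJoinB A) (bc B) ∧
        ∀ T : ℕ → Bool, P B T →
          ∃ S : ℕ → ℕ → Bool, Ψs.evalsTo (bc T) (seqJoinB S) ∧
            ∀ i, Q (A i) (S i) := by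
  classical
  have htot : ∀ Z : ℕ → Bool, ∃ C : ℕ → Bool, Φ.evalsTo (bc Z) (bc C) := by
    intro Z
    obtain ⟨C, hC, -⟩ := hred (fun n => Z (2 * n)) (fun n => Z (2 * n + 1))
    refine ⟨C, ?_⟩
    convert hC using 1
    funext n
    unfold join2 bc
    by_cases h : n % 2 = 0
    · rw [if_pos h]; congr 2; omega
    · rw [if_neg h]; congr 2; omega
  obtain ⟨u, huc, humono, hule, hu⟩ := exists_use Φ htot
  set m := cut u with hmdef
  have hm : Computable m := cut_computable huc
  refine ⟨fwd Φ hm, bwd Θ Ψ hm, fun A => ?_⟩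
  -- binary approximations
  have hbin : ∀ l, Sub l (seqJoinB A) → ∀ e i, ∃ X : ℕ → Bool, Sub (w Φ m l i e) (bc X) := by
    intro l hl e
    induction e with
    | zero =>
      intro i
      refine ⟨fun _ => false, fun j a h => ?_⟩
      rcases modL_get h with ⟨_, rfl⟩ | ⟨_, h2⟩
      · rfl
      · simp at h2
    | succ e ih =>
      intro i
      obtain ⟨X, hX⟩ := ih (i + 1)
      obtain ⟨C, hC, -⟩ := hred (A i) X
      refine ⟨fun n => if n < m i then false else C n, fun j a h => ?_⟩
      rw [w_succ] at h
      rcases modL_get h with ⟨h1, rfl⟩ | ⟨h1, h2⟩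
      · simp [bc, h1]
      · have h3 := (ap_appr hC).1 _ (joinL_sub ((col_appr i A).1 l hl) hX) j a h2
        simpa [bc, not_lt.2 h1] using h3
  -- length
  have hlen : ∀ e i n, u^[e] n ≤ m (i + e) → ∃ k, ∀ l, Sub l (seqJoinB A) → k ≤ l.length →
      n ≤ (w Φ m l i e).length := by
    intro e
    induction e with
    | zero =>
      intro i n h
      exact ⟨0, fun l _ _ => le_trans h (modL_length_left _ _)⟩
    | succ e ih =>
      intro i n h
      obtain ⟨k, hk⟩ := ih (i + 1) (u n) (by
        rw [show i + 1 + e = i + (e + 1) by omega]; exact h)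
      obtain ⟨k', hk'⟩ := (col_appr i A).2 (u n)
      refine ⟨max k k', fun l hl hll => ?_⟩
      rw [w_succ]
      refine le_trans ?_ (modL_length_right _ _)
      obtain ⟨X, hX⟩ := hbin l hl e (i + 1)
      have hj := joinL_sub ((col_appr i A).1 l hl) hX
      refine hu n _ (fun n => if n % 2 = 0 then A i (n / 2) else X (n / 2)) ?_
        (joinL_length (hk' l hl (by omega)) (hk l hl (by omega)))
      convert hj using 1
      funext n
      unfold join2 bc
      by_cases h : n % 2 = 0 <;> simp [h]
  have hlen' : ∀ i n, ∃ s, n ≤ (w Φ m (tab s (seqJoinB A)) i s).length := by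
    intro i n
    obtain ⟨k, hk⟩ := hlen n i n (by
      rw [hmdef, cut_eq]
      calc u^[n] n ≤ u^[n] (u^[i] (i + n)) := by
            apply humono.iterate
            exact le_trans (Nat.le_add_left n i) (Function.id_le_iterate_of_id_le hule i (i + n))
        _ = u^[i + n] (i + n) := by
            rw [← Function.iterate_add_apply, Nat.add_comm n i])
    refine ⟨max k n, (hk (tab (max k n) _) (tab_sub _ _) (by simp)).trans ?_⟩
    exact (w_mono Φ m (List.prefix_refl _) (le_max_right _ _) i).length_le
  have hB : ∀ i x : ℕ, ∃ b : Bool, ∃ s, (w Φ m (tab s (seqJoinB A)) i s)[x]? = some b.toNat := by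
    intro i x
    obtain ⟨s, hs⟩ := hlen' i (x + 1)
    obtain ⟨a, ha⟩ := get_of_lt (Nat.lt_of_succ_le hs)
    obtain ⟨X, hX⟩ := hbin _ (tab_sub s _) s i
    exact ⟨X x, s, by rw [ha, ← hX _ _ ha]; rfl⟩
  choose B sB hBs using hB
  have htab : ∀ {s s' : ℕ}, s ≤ s' → tab s (seqJoinB A) <+: tab s' (seqJoinB A) :=
    fun h => tab_pre (tab_sub _ _) (by simpa using h)
  have hsub : ∀ s i e, Squash.Sub (w Φ m (tab s (seqJoinB A)) i e) (bc (B i)) := by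
    intro s i e x a hx
    have h1 := prefix_get (w_mono Φ m (htab (s' := max (max s e) (sB i x)) (by omega))
      (e' := max (max s e) (sB i x)) (by omega) i) hx
    have h2 := prefix_get (w_mono Φ m (htab (s' := max (max s e) (sB i x)) (by omega))
      (e' := max (max s e) (sB i x)) (by omega) i) (hBs i x)
    rw [h1] at h2
    exact (Option.some.inj h2).symm
  -- agreement above the cutoff
  have hagree : ∀ i (C : ℕ → Bool), Φ.evalsTo (join2 (bc (A i)) (bc (B (i + 1)))) (bc C) →
      ∀ x, m i ≤ x → B i x = C x := by
    intro i C hC x hx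
    have h1 := prefix_get (w_mono Φ m (List.prefix_refl _) (Nat.le_succ (sB i x)) i) (hBs i x)
    rw [Nat.succ_eq_add_one, w_succ] at h1
    rcases modL_get h1 with ⟨h2, _⟩ | ⟨_, h2⟩
    · omega
    · have h3 := (ap_appr hC).1 _ (joinL_sub ((col_appr i A).1 _ (tab_sub _ _))
        (hsub (sB i x) (i + 1) (sB i x))) x _ h2
      exact bc_inj h3.symm
  refine ⟨B 0, ?_, ?_⟩
  · intro x
    refine ⟨sB 0 x, ?_⟩
    have h1 := hBs 0 x
    change (w Φ m (tab (sB 0 x) (seqJoinB A)) 0 (tab (sB 0 x) (seqJoinB A)).length)[x]? = _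
    rw [tab_length]
    exact h1
  intro T hT
  have step : ∀ i (Ti : ℕ → Bool), P (B i) Ti → Appr (fun l => tt Θ Ψ m l i) (bc T) (bc Ti) →
      ∃ SA SB : ℕ → Bool, Q (A i) SA ∧ P (B (i + 1)) SB ∧
        Appr (fun l => ss Θ Ψ m l i) (bc T) (bc SA) ∧
        Appr (fun l => tt Θ Ψ m l (i + 1)) (bc T) (bc SB) := by
    intro i Ti hTi hap
    obtain ⟨C, hC, hC2⟩ := hred (A i) (B (i + 1))
    obtain ⟨S₂, hS, hP⟩ := hTol (B i) C (m i) (hagree i C hC) Ti hTi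
    obtain ⟨SA, SB, hΨ, hQ, hPB⟩ := hC2 S₂ hP
    have h0 := (ap_appr hΨ).comp ((ap_appr hS).comp ((jm_appr (bc Ti) (m i)).comp hap))
    refine ⟨SA, SB, hQ, hPB, ?_, ?_⟩
    · refine (part_appr 0 (join2 (bc SA) (bc SB)) (bc SA) fun n => ?_).comp h0
      simp [join2]
    · refine (part_appr 1 (join2 (bc SA) (bc SB)) (bc SB) fun n => ?_).comp h0
      have e1 : (2 * n + 1) % 2 = 1 := by omega
      have e2 : (2 * n + 1) / 2 = n := by omega
      simp [join2, e1, e2]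
  have hall : ∀ i, ∃ Ti : ℕ → Bool, P (B i) Ti ∧
      Appr (fun l => tt Θ Ψ m l i) (bc T) (bc Ti) := by
    intro i
    induction i with
    | zero => exact ⟨T, hT, fun L hL => hL, fun n => ⟨n, fun L _ h => h⟩⟩
    | succ i ih =>
      obtain ⟨Ti, h1, h2⟩ := ih
      obtain ⟨SA, SB, -, h3, -, h4⟩ := step i Ti h1 h2
      exact ⟨SB, h3, h4⟩
  have hS : ∀ i, ∃ SA : ℕ → Bool, Q (A i) SA ∧ Appr (fun l => ss Θ Ψ m l i) (bc T) (bc SA) := by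
    intro i
    obtain ⟨Ti, h1, h2⟩ := hall i
    obtain ⟨SA, SB, h3, -, h4, -⟩ := step i Ti h1 h2
    exact ⟨SA, h3, h4⟩
  choose S hSQ hSA using hS
  refine ⟨S, fun n => ?_, hSQ⟩
  obtain ⟨k, hk⟩ := (hSA n.unpair.1).2 (n.unpair.2 + 1)
  refine ⟨k, ?_⟩
  change (ss Θ Ψ m (tab k (bc T)) n.unpair.1)[n.unpair.2]? = _
  obtain ⟨a, ha⟩ := get_of_lt (Nat.lt_of_succ_le (hk (tab k (bc T)) (tab_sub _ _) (by simp)))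
  have h1 := (hSA n.unpair.1).1 _ (tab_sub k _) _ _ ha
  rw [ha, ← h1]
  rfl
end

section
/- Let Φ be a Turing functional and q > 0 a rational. Then there exists a bounded coloring f : [ℕ]^2 → ℕ (each color used at most finitely often, in fact at most k times for some k) such that the set {S ∈ 2^ω : Φ(S) is (the characteristic function of) an infinite rainbow for f} has uniform measure less than q; moreover an index for f as a computable function can be found uniformly computably from q and an index for Φ. -/
open MeasureTheory

/-- The binary-digit expansion map `[0,1) → 2^ω`. -/
noncomputable def binDigits (x : ℝ) : ℕ → Bool := fun n => decide (⌊x * 2 ^ (n + 1)⌋ % 2 = 1)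

/-- The uniform (fair-coin product) measure on Cantor space, realized as the
pushforward of Lebesgue measure on `[0,1)` under binary expansion. -/
noncomputable def cantorMeasure : Measure (ℕ → Bool) :=
  (volume.restrict (Set.Ico (0 : ℝ) 1)).map binDigits

/-- A tree is a prefix-closed set of finite binary strings. -/
def IsTree (T : Set (List Bool)) : Prop := ∀ l ∈ T, ∀ l', l' <+: l → l' ∈ T

/-- The set of infinite paths through a tree. -/
def pathSet (T : Set (List Bool)) : Set (ℕ → Bool) :=
  {X | ∀ n, (List.range n).map X ∈ T}

/-- `e` is an index for the Turing functional `Φ`: the `e`-th partial computable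
function computes `Φ`'s approximation function (on codes). -/
def IndexOf (e : ℕ) (Φ : TuringFunctional) : Prop :=
  ∀ (l : List ℕ) (n : ℕ),
    (Denumerable.ofNat Nat.Partrec.Code e).eval (Nat.pair (Encodable.encode l) n) =
      Part.some (Encodable.encode (Φ.approx l n))

/-- `e` is an index for the total computable coloring `f : [ℕ]^2 → ℕ` (on pair codes). -/
def IndexOfColoring (e : ℕ) (f : ℕ → ℕ → ℕ) : Prop :=
  ∀ x y : ℕ,
    (Denumerable.ofNat Nat.Partrec.Code e).eval (Nat.pair x y) = Part.some (f x y)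

/-- `R` (a set given by `Y : ℕ → Bool`) is an infinite rainbow for `f` on pairs:
`f` is injective on 2-element subsets of `R`. -/
def IsInfRainbow (f : ℕ → ℕ → ℕ) (Y : ℕ → Bool) : Prop :=
  {n | Y n = true}.Infinite ∧
  ∀ x y x' y', Y x = true → Y y = true → Y x' = true → Y y' = true →
    x < y → x' < y' → f x y = f x' y' → x = x' ∧ y = y'

theorem den_bound (q : ℚ) : q.den ≤ Nat.pair (2 * @Encodable.encode ℚ (Rat.instDenumerable.toEncodable) q) 1 := by
  have raw_eq : ∀ q : ℚ, Rat.instEncodable.encode q = Nat.pair (Encodable.encode q.num) q.den := fun q => rfl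
  have raw_nat : ∀ n : ℕ, Rat.instEncodable.encode (n : ℚ) = Nat.pair (2 * n) 1 := fun q => rfl
  let := @Encodable.decidableRangeEncode ℚ Rat.instEncodable
  let : Infinite (Set.range (@Encodable.encode ℚ Rat.instEncodable)) :=
    Infinite.of_injective _ (Equiv.ofInjective _ Encodable.encode_injective).injective
  have key : ∀ n, (Nat.Subtype.ofNat (Set.range (@Encodable.encode ℚ Rat.instEncodable)) n) ≤ 
      (⟨Nat.pair (2 * n) 1, (n : ℚ), raw_nat n⟩ : Set.range (@Encodable.encode ℚ Rat.instEncodable)) := by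
    intro n
    induction n with
    | zero => exact bot_le
    | succ n ih =>
      refine Nat.Subtype.succ_le_of_lt (lt_of_le_of_lt ih ?_)
      have : Nat.pair (2 * n) 1 < Nat.pair (2 * (n + 1)) 1 := Nat.pair_lt_pair_left _ (by omega)
      exact this
  have h2 : ∀ n, Rat.instEncodable.encode (@Denumerable.ofNat ℚ Rat.instDenumerable n) = Nat.Subtype.ofNat (Set.range (@Encodable.encode ℚ Rat.instEncodable)) n := by
    intro n
    let := Nat.Subtype.denumerable (Set.range (@Encodable.encode ℚ Rat.instEncodable))
    have h : @Denumerable.ofNat ℚ Rat.instDenumerable n = (@Encodable.equivRangeEncode ℚ Rat.instEncodable).symm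
       (Denumerable.ofNat _ n) := Denumerable.ofEquiv_ofNat _ _ n
    have h' : (Denumerable.ofNat (Set.range (@Encodable.encode ℚ Rat.instEncodable)) n) = Nat.Subtype.ofNat (Set.range (@Encodable.encode ℚ Rat.instEncodable)) n := 
      Denumerable.ofEquiv_ofNat _ _ n
    rw [← h']
    exact congrArg Subtype.val ((Equiv.eq_symm_apply _).1 h)
  have h3 := h2 (@Encodable.encode ℚ (Rat.instDenumerable.toEncodable) q)
  rw [Denumerable.ofNat_encode, raw_eq] at h3
  refine (Nat.right_le_pair (Encodable.encode q.num) q.den).trans ?_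
  rw [h3]
  exact key _

open Nat.Partrec (Code)
theorem pow_primrec : Primrec₂ ((· ^ ·) : ℕ → ℕ → ℕ) := Primrec₂.unpaired'.1 Nat.Primrec.pow

/-- The binary string of length `u` with value `v` (most significant digit first). -/
def bstr (u v : ℕ) : List ℕ := (List.range u).map fun i => v / 2 ^ (u - 1 - i) % 2

/-- `w` codes a witness that the oracle string `(t, v)` outputs two elements. -/
def GoodW (e t v w : ℕ) : Prop :=
  w.unpair.2.unpair.1 < w.unpair.2.unpair.2 ∧
  Code.evaln t (Denumerable.ofNat Code e)
    (Nat.pair (Encodable.encode (bstr w.unpair.1 (v / 2 ^ (t - w.unpair.1)))) w.unpair.2.unpair.1)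
      = some 2 ∧
  Code.evaln t (Denumerable.ofNat Code e)
    (Nat.pair (Encodable.encode (bstr w.unpair.1 (v / 2 ^ (t - w.unpair.1)))) w.unpair.2.unpair.2)
      = some 2

/-- At stage `t`, the oracle string of length `t` with value `v` outputs two elements. -/
def Good (e t v : ℕ) : Prop := ∃ w < t, GoodW e t v w

open Classical in
/-- Number of good strings at stage `t`. -/
noncomputable def cnt (e t : ℕ) : ℕ := ((List.range (2 ^ t)).filter (fun v => Good e t v)).length

/-- Number of multiples of `1 / N` reached at stage `t`. -/
noncomputable def lev (N e t : ℕ) : ℕ := N * cnt e t / 2 ^ t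

/-- The coloring. -/
noncomputable def col (N e x s : ℕ) : ℕ :=
  if lev N e x = lev N e s then Nat.pair (x + 1) s else Nat.pair 0 s

theorem bstr_primrec : Primrec₂ bstr := by
  unfold bstr
  refine Primrec.list_map (Primrec.list_range.comp Primrec.fst) ?_
  refine Primrec.nat_mod.comp (Primrec.nat_div.comp (Primrec.snd.comp Primrec.fst)
    (pow_primrec.comp (Primrec.const 2) (Primrec.nat_sub.comp
      (Primrec.nat_sub.comp (Primrec.fst.comp Primrec.fst) (Primrec.const 1)) Primrec.snd))) (Primrec.const 2)

theorem goodW_primrec : PrimrecRel fun (w : ℕ) (p : ℕ × ℕ × ℕ) => GoodW p.1 p.2.1 p.2.2 w := by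
  have hw : Primrec fun a : ℕ × ℕ × ℕ × ℕ => a.1 := Primrec.fst
  have he : Primrec fun a : ℕ × ℕ × ℕ × ℕ => a.2.1 := Primrec.fst.comp Primrec.snd
  have ht : Primrec fun a : ℕ × ℕ × ℕ × ℕ => a.2.2.1 :=
    Primrec.fst.comp (Primrec.snd.comp Primrec.snd)
  have hv : Primrec fun a : ℕ × ℕ × ℕ × ℕ => a.2.2.2 :=
    Primrec.snd.comp (Primrec.snd.comp Primrec.snd)
  have hu : Primrec fun a : ℕ × ℕ × ℕ × ℕ => a.1.unpair.1 :=
    Primrec.fst.comp (Primrec.unpair.comp hw)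
  have hn : Primrec fun a : ℕ × ℕ × ℕ × ℕ => a.1.unpair.2.unpair.1 :=
    Primrec.fst.comp (Primrec.unpair.comp (Primrec.snd.comp (Primrec.unpair.comp hw)))
  have hm : Primrec fun a : ℕ × ℕ × ℕ × ℕ => a.1.unpair.2.unpair.2 :=
    Primrec.snd.comp (Primrec.unpair.comp (Primrec.snd.comp (Primrec.unpair.comp hw)))
  have hb : Primrec fun a : ℕ × ℕ × ℕ × ℕ =>
      Encodable.encode (bstr a.1.unpair.1 (a.2.2.2 / 2 ^ (a.2.2.1 - a.1.unpair.1))) :=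
    Primrec.encode.comp (bstr_primrec.comp hu (Primrec.nat_div.comp hv
      (pow_primrec.comp (Primrec.const 2) (Primrec.nat_sub.comp ht hu))))
  have hc : Primrec fun a : ℕ × ℕ × ℕ × ℕ => Denumerable.ofNat Code a.2.1 :=
    (Primrec.ofNat Code).comp he
  have hev : ∀ {g : ℕ × ℕ × ℕ × ℕ → ℕ}, Primrec g → PrimrecPred fun a : ℕ × ℕ × ℕ × ℕ =>
      Code.evaln a.2.2.1 (Denumerable.ofNat Code a.2.1)
        (Nat.pair (Encodable.encode (bstr a.1.unpair.1 (a.2.2.2 / 2 ^ (a.2.2.1 - a.1.unpair.1))))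
          (g a)) = some 2 := fun hg =>
    Primrec.eq.comp (Code.primrec_evaln.comp (Primrec.pair (Primrec.pair ht hc)
      (Primrec₂.natPair.comp hb hg))) (Primrec.const (some 2))
  exact (Primrec.nat_lt.comp hn hm).and ((hev hn).and (hev hm))

theorem good_primrec : PrimrecRel fun (v : ℕ) (p : ℕ × ℕ) => Good p.1 p.2 v := by
  have h := (goodW_primrec.exists_mem_list).comp
    (Primrec.list_range.comp (Primrec.snd.comp Primrec.snd) : Primrec fun a : ℕ × ℕ × ℕ => List.range a.2.2)
    (Primrec.pair (Primrec.fst.comp Primrec.snd)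
      (Primrec.pair (Primrec.snd.comp Primrec.snd) Primrec.fst) : Primrec fun a : ℕ × ℕ × ℕ => (a.2.1, a.2.2, a.1))
  refine PrimrecPred.of_eq h fun a => ?_
  simp [Good]

open Classical in
theorem cnt_primrec : Primrec₂ cnt := by
  have h := Primrec.list_length.comp ((good_primrec.listFilter).comp
    (Primrec.list_range.comp (pow_primrec.comp (Primrec.const 2) Primrec.snd) : Primrec fun a : ℕ × ℕ => List.range (2 ^ a.2))
    Primrec.id)
  refine Primrec.of_eq h fun a => ?_
  simp [cnt]

theorem lev_primrec : Primrec fun a : ℕ × ℕ × ℕ => lev a.1 a.2.1 a.2.2 :=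
  Primrec.nat_div.comp (Primrec.nat_mul.comp Primrec.fst (cnt_primrec.comp (Primrec.fst.comp Primrec.snd)
    (Primrec.snd.comp Primrec.snd))) (pow_primrec.comp (Primrec.const 2) (Primrec.snd.comp Primrec.snd))

theorem col_primrec : Primrec fun a : (ℕ × ℕ) × (ℕ × ℕ) => col a.1.1 a.1.2 a.2.1 a.2.2 := by
  have hN : Primrec fun a : (ℕ × ℕ) × (ℕ × ℕ) => a.1.1 := Primrec.fst.comp Primrec.fst
  have he : Primrec fun a : (ℕ × ℕ) × (ℕ × ℕ) => a.1.2 := Primrec.snd.comp Primrec.fst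
  have hx : Primrec fun a : (ℕ × ℕ) × (ℕ × ℕ) => a.2.1 := Primrec.fst.comp Primrec.snd
  have hs : Primrec fun a : (ℕ × ℕ) × (ℕ × ℕ) => a.2.2 := Primrec.snd.comp Primrec.snd
  exact Primrec.ite (Primrec.eq.comp (lev_primrec.comp (Primrec.pair hN (Primrec.pair he hx)))
    (lev_primrec.comp (Primrec.pair hN (Primrec.pair he hs))))
    (Primrec₂.natPair.comp (Primrec.succ.comp hx) hs) (Primrec₂.natPair.comp (Primrec.const 0) hs)

theorem exists_index : ∃ c : Code, ∀ n e x s : ℕ,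
    Code.eval c (Nat.pair (Nat.pair n e) (Nat.pair x s)) =
      Part.some (col (Nat.pair (2 * n) 1 + 1) e x s) := by
  have h1 : Primrec fun m : ℕ => m.unpair.1.unpair.1 := Primrec.fst.comp (Primrec.unpair.comp (Primrec.fst.comp Primrec.unpair))
  have h2 : Primrec fun m : ℕ => m.unpair.1.unpair.2 := Primrec.snd.comp (Primrec.unpair.comp (Primrec.fst.comp Primrec.unpair))
  have h3 : Primrec fun m : ℕ => m.unpair.2.unpair := (Primrec.unpair.comp (Primrec.snd.comp Primrec.unpair))
  have h : Primrec fun m : ℕ => col (Nat.pair (2 * m.unpair.1.unpair.1) 1 + 1)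
      m.unpair.1.unpair.2 m.unpair.2.unpair.1 m.unpair.2.unpair.2 :=
    col_primrec.comp (Primrec.pair (Primrec.pair (Primrec.succ.comp (Primrec₂.natPair.comp
      (Primrec.nat_mul.comp (Primrec.const 2) h1) (Primrec.const 1))) h2) h3)
  obtain ⟨c, hc⟩ := Code.exists_code.1 (Nat.Partrec.of_primrec (Primrec.nat_iff.1 h))
  refine ⟨c, fun n e x s => ?_⟩
  rw [hc]
  simp

theorem good_mono {e a d v : ℕ} (h : Good e a (v / 2 ^ d)) : Good e (a + d) v := by
  obtain ⟨w, hw, h1, h2, h3⟩ := h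
  have hu : w.unpair.1 ≤ w := Nat.unpair_left_le w
  have key : v / 2 ^ (a + d - w.unpair.1) = v / 2 ^ d / 2 ^ (a - w.unpair.1) := by
    rw [Nat.div_div_eq_div_mul, ← pow_add]
    congr 2
    omega
  refine ⟨w, by omega, h1, ?_, ?_⟩
  · rw [key]; exact Code.evaln_mono (Nat.le_add_right a d) h2
  · rw [key]; exact Code.evaln_mono (Nat.le_add_right a d) h3

open Classical in
theorem cnt_eq (e t : ℕ) : cnt e t = ((Finset.range (2 ^ t)).filter (fun v => Good e t v)).card := rfl

open Classical in
theorem card_div (p : ℕ → Prop) (A K : ℕ) (hK : 0 < K) :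
    ((Finset.range (A * K)).filter (fun v => p (v / K))).card =
      K * ((Finset.range A).filter p).card := by
  rw [mul_comm K, ← Finset.card_range K, ← Finset.card_product, Finset.card_range]
  refine Finset.card_nbij' (fun v => (v / K, v % K)) (fun q => q.1 * K + q.2) ?_ ?_ ?_ ?_
  · intro v hv
    simp at hv ⊢
    exact ⟨⟨Nat.div_lt_of_lt_mul (by rw [mul_comm]; exact hv.1), hv.2⟩, Nat.mod_lt _ hK⟩
  · rintro ⟨w, r⟩ hq
    simp at hq ⊢
    have : (w * K + r) / K = w := by
      rw [mul_comm, Nat.mul_add_div hK, Nat.div_eq_of_lt hq.2, add_zero]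
    rw [this]
    refine ⟨?_, hq.1.2⟩
    nlinarith [hq.1.1, hq.2]
  · intro v _
    exact Nat.div_add_mod' v K
  · rintro ⟨w, r⟩ hq
    simp at hq ⊢
    constructor
    · rw [mul_comm, Nat.mul_add_div hK, Nat.div_eq_of_lt hq.2, add_zero]
    · exact Nat.mod_eq_of_lt hq.2

open Classical in
theorem cnt_split (e a d : ℕ) :
    ((Finset.range (2 ^ (a + d))).filter
      (fun v => Good e (a + d) v ∧ ¬ Good e a (v / 2 ^ d))).card + 2 ^ d * cnt e a
      = cnt e (a + d) := by
  rw [cnt_eq, cnt_eq, ← card_div (Good e a) _ _ (by positivity), ← pow_add]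
  rw [← Finset.card_union_of_disjoint]
  · congr 1
    ext v
    simp only [Finset.mem_union, Finset.mem_filter]
    have := @good_mono e a d v
    tauto
  · rw [Finset.disjoint_left]
    intro v hv hv'
    simp only [Finset.mem_filter] at hv hv'
    tauto

theorem lev_mono (N e : ℕ) : Monotone (lev N e) := by
  intro a t hat
  obtain ⟨d, rfl⟩ := Nat.exists_eq_add_of_le hat
  unfold lev
  rw [Nat.le_div_iff_mul_le (by positivity), pow_add, ← mul_assoc]
  have h1 := Nat.div_mul_le_self (N * cnt e a) (2 ^ a)
  have h2 := cnt_split e a d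
  calc N * cnt e a / 2 ^ a * 2 ^ a * 2 ^ d ≤ N * cnt e a * 2 ^ d := Nat.mul_le_mul_right _ h1
    _ = N * (2 ^ d * cnt e a) := by ring
    _ ≤ N * cnt e (a + d) := Nat.mul_le_mul_left _ (by omega)

theorem lev_le (N e t : ℕ) : lev N e t ≤ N := by
  unfold lev
  apply Nat.div_le_of_le_mul
  rw [mul_comm]
  apply Nat.mul_le_mul_right
  exact (List.length_filter_le _ _).trans (by simp)

theorem lev_stable (N e : ℕ) : ∃ a, (∀ t, a ≤ t → lev N e t = lev N e a) ∧
    ∀ x, x < a → lev N e x ≠ lev N e a := by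
  classical
  have h : ∃ a, ∀ t, a ≤ t → lev N e t = lev N e a := by
    refine ⟨Function.argmin (fun t => N - lev N e t), fun t ht => ?_⟩
    have h1 := Function.argmin_le (fun t => N - lev N e t) t
    have h2 := lev_mono N e ht
    have h3 := lev_le N e t
    omega
  refine ⟨Nat.find h, Nat.find_spec h, fun x hx heq => Nat.find_min h hx fun t ht => ?_⟩
  have hs := Nat.find_spec h
  rcases le_total (Nat.find h) t with h1 | h1
  · rw [hs t h1, heq]
  · have h2 := lev_mono N e h1
    have h3 := lev_mono N e ht
    omega

open Classical in
theorem diff_bound (N e a d : ℕ) (h : lev N e (a + d) = lev N e a) :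
    N * ((Finset.range (2 ^ (a + d))).filter
      (fun v => Good e (a + d) v ∧ ¬ Good e a (v / 2 ^ d))).card ≤ 2 ^ (a + d) := by
  have hs := cnt_split e a d
  set D := ((Finset.range (2 ^ (a + d))).filter
      (fun v => Good e (a + d) v ∧ ¬ Good e a (v / 2 ^ d))).card
  have h1 : lev N e a * 2 ^ a ≤ N * cnt e a := Nat.div_mul_le_self _ _
  have h2 : N * cnt e (a + d) < (lev N e (a + d) + 1) * 2 ^ (a + d) :=
    Nat.lt_mul_of_div_lt (Nat.lt_succ_self _) (by positivity)
  rw [h, ← hs] at h2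
  have h3 := Nat.mul_le_mul_right (2 ^ d) h1
  rw [pow_add] at h2 ⊢
  nlinarith

/-- Value of the first `t` bits of `S`. -/
def num (S : ℕ → Bool) : ℕ → ℕ
  | 0 => 0
  | t + 1 => 2 * num S t + bc S t

theorem bc_lt (S : ℕ → Bool) (t : ℕ) : bc S t < 2 := by
  unfold bc; cases S t <;> simp

theorem num_lt (S : ℕ → Bool) (t : ℕ) : num S t < 2 ^ t := by
  induction t with
  | zero => simp [num]
  | succ t ih => rw [num, pow_succ]; have := bc_lt S t; omega

theorem num_div (S : ℕ → Bool) (u d : ℕ) : num S (u + d) / 2 ^ d = num S u := by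
  induction d with
  | zero => simp
  | succ d ih =>
    rw [← add_assoc, num, pow_succ', ← Nat.div_div_eq_div_mul]
    have := bc_lt S (u + d)
    rw [show (2 * num S (u + d) + bc S (u + d)) / 2 = num S (u + d) by omega, ih]

theorem num_div' (S : ℕ → Bool) {u t : ℕ} (h : u ≤ t) : num S t / 2 ^ (t - u) = num S u := by
  obtain ⟨d, rfl⟩ := Nat.exists_eq_add_of_le h
  rw [Nat.add_sub_cancel_left, num_div]

theorem bstr_num (S : ℕ → Bool) (u : ℕ) : bstr u (num S u) = (List.range u).map (bc S) := by
  unfold bstr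
  apply List.map_congr_left
  intro i hi
  rw [List.mem_range] at hi
  rw [Nat.sub_sub, num_div' S (by omega), add_comm, num]
  have := bc_lt S i
  omega

theorem num_measurable (t : ℕ) : Measurable fun S : ℕ → Bool => num S t := by
  induction t with
  | zero => exact measurable_const
  | succ t ih =>
    have : Measurable fun p : ℕ × Bool => 2 * p.1 + p.2.toNat := measurable_of_countable _
    exact this.comp (ih.prodMk (measurable_pi_apply t))

theorem binDigits_measurable : Measurable binDigits := by
  refine measurable_pi_iff.2 fun n => ?_
  have : Measurable fun z : ℤ => decide (z % 2 = 1) := measurable_of_countable _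
  exact this.comp (Int.measurable_floor.comp (measurable_id.mul_const _))

theorem num_binDigits {x : ℝ} (hx : x ∈ Set.Ico (0 : ℝ) 1) (t : ℕ) :
    (num (binDigits x) t : ℤ) = ⌊x * 2 ^ t⌋ := by
  induction t with
  | zero =>
    simp only [num, pow_zero, mul_one]
    symm
    simpa using hx
  | succ t ih =>
    have h1 : ⌊x * 2 ^ (t + 1)⌋ / 2 = ⌊x * 2 ^ t⌋ := by
      have := Int.floor_div_natCast (x * 2 ^ (t + 1)) 2
      have h2 : x * 2 ^ (t + 1) / ((2 : ℕ) : ℝ) = x * 2 ^ t := by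
        push_cast
        rw [pow_succ]
        ring
      rw [h2] at this
      exact this.symm
    have h2 : (bc (binDigits x) t : ℤ) = ⌊x * 2 ^ (t + 1)⌋ % 2 := by
      unfold bc binDigits
      by_cases h : ⌊x * 2 ^ (t + 1)⌋ % 2 = 1
      · simp [h]
      · have : ⌊x * 2 ^ (t + 1)⌋ % 2 = 0 := by omega
        simp [this]
    rw [num]
    push_cast
    rw [h2, ih]
    omega

/-- Oracles that become good after stage `a`. -/
def badSet (e a d : ℕ) : Set (ℕ → Bool) :=
  {S | Good e (a + d) (num S (a + d)) ∧ ¬ Good e a (num S a)}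

theorem badSet_measurable (e a d : ℕ) : MeasurableSet (badSet e a d) := by
  have h1 : MeasurableSet {S : ℕ → Bool | Good e (a + d) (num S (a + d))} :=
    num_measurable (a + d) (MeasurableSet.of_discrete (s := {v | Good e (a + d) v}))
  have h2 : MeasurableSet {S : ℕ → Bool | Good e a (num S a)} :=
    num_measurable a (MeasurableSet.of_discrete (s := {v | Good e a v}))
  exact h1.inter h2.compl

theorem badSet_mono (e a : ℕ) : Monotone (badSet e a) := by
  intro d d' h S hS
  obtain ⟨k, rfl⟩ := Nat.exists_eq_add_of_le h
  refine ⟨?_, hS.2⟩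
  rw [← add_assoc]
  apply good_mono
  rw [num_div]
  exact hS.1

theorem cantor_cyl (t v : ℕ) :
    cantorMeasure {S | num S t = v} ≤ ENNReal.ofReal (1 / 2 ^ t) := by
  have hm : MeasurableSet {S : ℕ → Bool | num S t = v} :=
    num_measurable t (measurableSet_singleton v)
  rw [cantorMeasure, Measure.map_apply binDigits_measurable hm,
    Measure.restrict_apply (binDigits_measurable hm)]
  have hp : (0 : ℝ) < 2 ^ t := by positivity
  have hsub : binDigits ⁻¹' {S | num S t = v} ∩ Set.Ico (0 : ℝ) 1 ⊆
      Set.Ico ((v : ℝ) / 2 ^ t) ((v + 1 : ℝ) / 2 ^ t) := by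
    rintro x ⟨hx, hx1⟩
    have h := num_binDigits hx1 t
    have hx' : num (binDigits x) t = v := hx
    rw [hx'] at h
    have h' := Int.floor_eq_iff.1 h.symm
    push_cast at h'
    rw [Set.mem_Ico, div_le_iff₀ hp, lt_div_iff₀ hp]
    exact h'
  refine (measure_mono hsub).trans ?_
  rw [Real.volume_Ico]
  apply le_of_eq
  congr 1
  ring

theorem badSet_measure (N e a d : ℕ) (hN : 0 < N) (h : lev N e (a + d) = lev N e a) :
    cantorMeasure (badSet e a d) ≤ ENNReal.ofReal (1 / N) := by
  classical
  have hb := diff_bound N e a d h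
  set D := (Finset.range (2 ^ (a + d))).filter
      (fun v => Good e (a + d) v ∧ ¬ Good e a (v / 2 ^ d)) with hD
  have hsub : badSet e a d ⊆ ⋃ v ∈ D, {S | num S (a + d) = v} := by
    intro S hS
    simp only [Set.mem_iUnion]
    refine ⟨num S (a + d), ?_, rfl⟩
    rw [hD, Finset.mem_filter, Finset.mem_range, num_div]
    exact ⟨num_lt _ _, hS⟩
  calc cantorMeasure (badSet e a d) ≤ ∑ v ∈ D, cantorMeasure {S | num S (a + d) = v} :=
        (measure_mono hsub).trans (measure_biUnion_finset_le _ _)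
    _ ≤ ∑ v ∈ D, ENNReal.ofReal (1 / 2 ^ (a + d)) := Finset.sum_le_sum fun v _ => cantor_cyl _ _
    _ = ENNReal.ofReal (D.card * (1 / 2 ^ (a + d))) := by
        rw [Finset.sum_const, nsmul_eq_mul, ENNReal.ofReal_mul (by positivity),
          ENNReal.ofReal_natCast]
    _ ≤ ENNReal.ofReal (1 / N) := by
        apply ENNReal.ofReal_le_ofReal
        have hb' : (N : ℝ) * D.card ≤ 2 ^ (a + d) := by exact_mod_cast hb
        have : (0 : ℝ) < N := by exact_mod_cast hN
        rw [mul_one_div, div_le_div_iff₀ (by positivity) this]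
        linarith

theorem union_measure (N e a : ℕ) (hN : 0 < N) (h : ∀ t, a ≤ t → lev N e t = lev N e a) :
    cantorMeasure (⋃ d, badSet e a d) ≤ ENNReal.ofReal (1 / N) := by
  rw [(badSet_mono e a).measure_iUnion]
  exact iSup_le fun d => badSet_measure N e a d hN (h _ (by omega))

theorem evals_iff {Φ : TuringFunctional} {e : ℕ} (he : IndexOf e Φ) (l : List ℕ) (n : ℕ) :
    (∃ k, Code.evaln k (Denumerable.ofNat Code e) (Nat.pair (Encodable.encode l) n) = some 2) ↔
      Φ.approx l n = some 1 := by
  have h := he l n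
  have h2 : (∃ k, Code.evaln k (Denumerable.ofNat Code e) (Nat.pair (Encodable.encode l) n) = some 2)
      ↔ 2 ∈ (Denumerable.ofNat Code e).eval (Nat.pair (Encodable.encode l) n) :=
    Code.evaln_complete.symm
  rw [h2, h, Part.mem_some_iff, show (2 : ℕ) = Encodable.encode (some 1 : Option ℕ) from rfl,
    Encodable.encode_inj, eq_comm]

theorem prefix_range (X : ℕ → ℕ) {m n : ℕ} (h : m ≤ n) :
    (List.range m).map X <+: (List.range n).map X := by
  obtain ⟨d, rfl⟩ := Nat.exists_eq_add_of_le h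
  rw [List.range_add, List.map_append]
  exact List.prefix_append _ _

theorem evals_unique {Φ : TuringFunctional} {X Y : ℕ → ℕ} (h : Φ.evalsTo X Y) {u n b : ℕ}
    (hu : Φ.approx ((List.range u).map X) n = some b) : Y n = b := by
  obtain ⟨m, hm⟩ := h n
  have h1 := Φ.mono (prefix_range X (le_max_left u m)) hu
  have h2 := Φ.mono (prefix_range X (le_max_right u m)) hm
  rw [h1] at h2
  exact (Option.some.inj h2).symm

theorem bc_eq_one {Y : ℕ → Bool} {n : ℕ} : bc Y n = 1 ↔ Y n = true := by
  unfold bc; cases Y n <;> simp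

theorem subset_union {Φ : TuringFunctional} {N e a : ℕ} (he : IndexOf e Φ)
    (h1 : ∀ t, a ≤ t → lev N e t = lev N e a) (h2 : ∀ x, x < a → lev N e x ≠ lev N e a) :
    {S : ℕ → Bool | ∃ Y : ℕ → Bool, Φ.evalsTo (bc S) (bc Y) ∧ IsInfRainbow (col N e) Y} ⊆
      ⋃ d, badSet e a d := by
  rintro S ⟨Y, hev, hinf, hr⟩
  have hng : ¬ Good e a (num S a) := by
    rintro ⟨w, hw, hlt, hx, hy⟩
    have hu : w.unpair.1 ≤ w := Nat.unpair_left_le w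
    have hv : w.unpair.2 ≤ w := Nat.unpair_right_le w
    have hv2 : w.unpair.2.unpair.2 ≤ w.unpair.2 := Nat.unpair_right_le _
    rw [num_div' S (by omega), bstr_num] at hx hy
    have hx' := bc_eq_one.1 (evals_unique hev ((evals_iff he _ _).1 ⟨_, hx⟩))
    have hy' := bc_eq_one.1 (evals_unique hev ((evals_iff he _ _).1 ⟨_, hy⟩))
    obtain ⟨s, hs, has⟩ := hinf.exists_gt a
    have hs' : Y s = true := hs
    have hcx : ∀ x, x < a → col N e x s = Nat.pair 0 s := by
      intro x hx
      rw [col, if_neg]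
      rw [h1 s has.le]
      exact h2 x hx
    have := (hr _ s _ s hx' hs' hy' hs' (by omega) (by omega)
      ((hcx _ (by omega)).trans (hcx _ (by omega)).symm)).1
    omega
  obtain ⟨x, hx, _⟩ := hinf.exists_gt 0
  obtain ⟨y, hy, hxy⟩ := hinf.exists_gt x
  obtain ⟨m1, hm1⟩ := hev x
  obtain ⟨m2, hm2⟩ := hev y
  rw [bc_eq_one.2 hx] at hm1
  rw [bc_eq_one.2 hy] at hm2
  have hm1' := Φ.mono (prefix_range _ (le_max_left m1 m2)) hm1
  have hm2' := Φ.mono (prefix_range _ (le_max_right m1 m2)) hm2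
  generalize max m1 m2 = u at hm1' hm2'
  obtain ⟨k1, hk1⟩ := (evals_iff he _ _).2 hm1'
  obtain ⟨k2, hk2⟩ := (evals_iff he _ _).2 hm2'
  refine Set.mem_iUnion.2 ⟨Nat.pair u (Nat.pair x y) + 1 + k1 + k2, ?_, hng⟩
  have hu := Nat.left_le_pair u (Nat.pair x y)
  refine ⟨Nat.pair u (Nat.pair x y), by omega, ?_⟩
  simp only [GoodW, Nat.unpair_pair]
  rw [num_div' S (by omega), bstr_num]
  exact ⟨hxy, Code.evaln_mono (by omega) hk1, Code.evaln_mono (by omega) hk2⟩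

theorem col_bounded {N e a : ℕ} (h1 : ∀ t, a ≤ t → lev N e t = lev N e a) (c : ℕ) :
    {p : ℕ × ℕ | p.1 < p.2 ∧ col N e p.1 p.2 = c}.Finite ∧
      Nat.card {p : ℕ × ℕ | p.1 < p.2 ∧ col N e p.1 p.2 = c} ≤ a + 1 := by
  classical
  let T : Finset (ℕ × ℕ) :=
    (insert (c.unpair.1 - 1) (Finset.range a)).image fun x => (x, c.unpair.2)
  have hsub : {p : ℕ × ℕ | p.1 < p.2 ∧ col N e p.1 p.2 = c} ⊆ (T : Set (ℕ × ℕ)) := by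
    rintro ⟨x, s⟩ ⟨hlt, hc⟩
    simp only at hlt hc
    simp only [T, Finset.coe_image, Set.mem_image, Finset.mem_coe, Finset.mem_insert,
      Finset.mem_range]
    refine ⟨x, ?_, ?_⟩
    · by_cases hl : lev N e x = lev N e s
      · rw [col, if_pos hl] at hc
        left
        rw [← hc]
        simp
      · right
        by_contra hxa
        exact hl ((h1 x (by omega)).trans (h1 s (by omega)).symm)
    · rw [← hc, col]
      split_ifs <;> simp
  refine ⟨T.finite_toSet.subset hsub, ?_⟩
  rw [Nat.card_coe_set_eq]
  refine (Set.ncard_le_ncard hsub T.finite_toSet).trans ?_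
  rw [Set.ncard_coe_finset]
  refine Finset.card_image_le.trans ((Finset.card_insert_le _ _).trans ?_)
  simp

/-- For every Turing functional `Φ` and rational `q > 0` there is a bounded computable
coloring `f : [ℕ]^2 → ℕ` (each color used at most `k` times for some `k`) such that the
set of oracles `S ∈ 2^ω` for which `Φ(S)` is (the characteristic function of) an
infinite rainbow for `f` has uniform measure less than `q`; moreover an index for `f`
is obtained uniformly computably from `q` and an index for `Φ`. -/
theorem stmt19 :
    ∃ F : ℚ → ℕ → ℕ, (Computable₂ fun n e => F (Denumerable.ofNat ℚ n) e) ∧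
      ∀ q : ℚ, 0 < q → ∀ Φ : TuringFunctional, ∀ e : ℕ, IndexOf e Φ →
        ∃ f : ℕ → ℕ → ℕ, IndexOfColoring (F q e) f ∧
          (∃ k : ℕ, ∀ c : ℕ,
            {p : ℕ × ℕ | p.1 < p.2 ∧ f p.1 p.2 = c}.Finite ∧
            Nat.card {p : ℕ × ℕ | p.1 < p.2 ∧ f p.1 p.2 = c} ≤ k) ∧
          cantorMeasure {S : ℕ → Bool | ∃ Y : ℕ → Bool,
              Φ.evalsTo (bc S) (bc Y) ∧ IsInfRainbow f Y} <
            ENNReal.ofReal (q : ℝ) := by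
  obtain ⟨c, hc⟩ := exists_index
  refine ⟨fun q e => Encodable.encode
    (Code.curry c (Nat.pair (@Encodable.encode ℚ Rat.instDenumerable.toEncodable q) e)), ?_, ?_⟩
  · simp only [Denumerable.encode_ofNat]
    exact (Primrec.encode.comp (Code.primrec₂_curry.comp (Primrec.const c)
      Primrec₂.natPair)).to_comp
  · intro q hq Φ e he
    have hden := den_bound q
    generalize hn : @Encodable.encode ℚ Rat.instDenumerable.toEncodable q = n at hden ⊢
    obtain ⟨a, h1, h2⟩ := lev_stable (Nat.pair (2 * n) 1 + 1) e
    refine ⟨col (Nat.pair (2 * n) 1 + 1) e, ?_, ⟨a + 1, col_bounded h1⟩, ?_⟩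
    · intro x y
      simp only [hn, Denumerable.ofNat_encode, Code.eval_curry]
      exact hc n e x y
    · refine ((measure_mono (subset_union he h1 h2)).trans
        (union_measure _ e a (Nat.succ_pos _) h1)).trans_lt ?_
      have hq' : (0 : ℝ) < q := by exact_mod_cast hq
      rw [ENNReal.ofReal_lt_ofReal_iff hq']
      have hd : (0 : ℚ) < q.den := by exact_mod_cast q.den_pos
      have h3 : (1 : ℚ) / q.den ≤ q := by
        have hnum : (1 : ℚ) ≤ q.num := by exact_mod_cast Rat.num_pos.2 hq
        calc (1 : ℚ) / q.den ≤ q.num / q.den := by gcongr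
          _ = q := Rat.num_div_den q
      have h4 : (1 : ℚ) / ((Nat.pair (2 * n) 1 + 1 : ℕ) : ℚ) < 1 / q.den := by
        apply one_div_lt_one_div_of_lt hd
        exact_mod_cast Nat.lt_succ_of_le hden
      have h5 : (((1 : ℚ) / ((Nat.pair (2 * n) 1 + 1 : ℕ) : ℚ) : ℚ) : ℝ) < (q : ℝ) :=
        Rat.cast_lt.2 (h4.trans_le h3)
      rw [Rat.cast_div, Rat.cast_one, Rat.cast_natCast] at h5
      exact h5
end
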